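/- If a simplicial complex X is weakly Cohen–Macaulay of level n, then the ordered complex X^{ord}, whose k-simplices are the k-simplices of X equipped with a total ordering of their vertices, is (n−1)-connected. -/

import Mathlib

open scoped BigOperators

structure ASC (V : Type) where
  faces : Set (Finset V)
  nonempty_of_mem : ∀ ⦃s⦄, s ∈ faces → s.Nonempty
  down_closed : ∀ ⦃s t : Finset V⦄, s ∈ faces → t ⊆ s → t.Nonempty → t ∈ faces

namespace ASC

variable {V W : Type} [DecidableEq V] [DecidableEq W]

/-- The geometric realization of an abstract simplicial complex, as a subset of `V → ℝ`
(barycentric coordinates, with the product topology on the subtype). -/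
def space (K : ASC V) : Set (V → ℝ) :=
  {x | (∀ v, 0 ≤ x v) ∧ ∃ s ∈ K.faces, (∀ v, v ∉ s → x v = 0) ∧ ∑ v ∈ s, x v = 1}

/-- A vertex map is simplicial if it sends faces to faces. -/
def IsSimplicial (K : ASC V) (L : ASC W) (φ : V → W) : Prop :=
  ∀ s ∈ K.faces, s.image φ ∈ L.faces

/-- The map induced on geometric realizations by a vertex map. -/
noncomputable def push (φ : V → W) (x : V → ℝ) : W → ℝ :=
  fun w => ∑ᶠ v ∈ φ ⁻¹' {w}, x v

/-- The link of a simplex. -/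
def link (K : ASC V) (σ : Finset V) : ASC V where
  faces := {t | t ∈ K.faces ∧ Disjoint σ t ∧ σ ∪ t ∈ K.faces}
  nonempty_of_mem := fun _ ht => K.nonempty_of_mem ht.1
  down_closed := by
    rintro t u ⟨h1, h2, h3⟩ hsub hne
    exact ⟨K.down_closed h1 hsub hne, h2.mono_right hsub,
      K.down_closed h3 (Finset.union_subset_union_right hsub)
        ⟨hne.choose, Finset.mem_union_right _ hne.choose_spec⟩⟩

end ASC

/-- `n`-connectedness of a space (`n` an integer): nonempty when `n ≥ -1`, and all homotopy
groups in dimensions `≤ n` vanish, at every basepoint. -/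
def IsConn (X : Type) [TopologicalSpace X] (n : ℤ) : Prop :=
  (-1 ≤ n → Nonempty X) ∧
    ∀ i : ℕ, (i : ℤ) ≤ n → ∀ x : X, Subsingleton (HomotopyGroup (Fin i) X x)


/-- `K` is weakly Cohen–Macaulay of level `n`: it is `(n−1)`-connected and the link of each
`k`-simplex is `(n−k−2)`-connected. -/
def WCM {V : Type} [DecidableEq V] (K : ASC V) (n : ℤ) : Prop :=
  IsConn (↥K.space) (n - 1) ∧ ∀ s ∈ K.faces, IsConn (↥(K.link s).space) (n - s.card - 1)

/-- The standard geometric simplex with vertex set `Fin n`. -/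
def stdSimplexSet (n : ℕ) : Set (Fin n → ℝ) := {x | (∀ i, 0 ≤ x i) ∧ ∑ i, x i = 1}

/-- The affine inclusion of a face determined by a vertex map `e`. -/
noncomputable def faceInclude {k n : ℕ} (e : Fin k → Fin n) (w : Fin k → ℝ) : Fin n → ℝ :=
  fun i => ∑ᶠ j ∈ e ⁻¹' {i}, w j

/-- Points of the disjoint union of one geometric `k`-simplex for each ordered `k`-simplex
(injective vertex tuple spanning a face) of `K`. -/
def OrdPts {V : Type} [DecidableEq V] (K : ASC V) : Type :=
  Σ p : Σ k : ℕ, {f : Fin (k + 1) → V // Function.Injective f ∧ Finset.univ.image f ∈ K.faces},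
    ↥(stdSimplexSet (p.1 + 1))

instance {V : Type} [DecidableEq V] (K : ASC V) : TopologicalSpace (OrdPts K) := by
  unfold OrdPts; infer_instance

/-- The face identifications defining the geometric realization of the ordered complex
`K^{ord}` as a semi-simplicial complex. -/
def OrdRel {V : Type} [DecidableEq V] (K : ASC V) : OrdPts K → OrdPts K → Prop := fun a b =>
  ∃ (j k : ℕ) (f : Fin (k + 1) → V)
    (hf : Function.Injective f ∧ Finset.univ.image f ∈ K.faces)
    (e : Fin (j + 1) → Fin (k + 1)) (_ : StrictMono e)
    (w : ↥(stdSimplexSet (j + 1)))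
    (hmem : faceInclude e (w : Fin (j + 1) → ℝ) ∈ stdSimplexSet (k + 1))
    (hcomp : Function.Injective (f ∘ e) ∧ Finset.univ.image (f ∘ e) ∈ K.faces),
    a = ⟨⟨k, ⟨f, hf⟩⟩, ⟨faceInclude e (w : Fin (j + 1) → ℝ), hmem⟩⟩ ∧
      b = ⟨⟨j, ⟨f ∘ e, hcomp⟩⟩, w⟩

/-- The geometric realization of the ordered complex `K^{ord}`. -/
def OrdRealization {V : Type} [DecidableEq V] (K : ASC V) : Type := Quot (OrdRel K)

noncomputable instance {V : Type} [DecidableEq V] (K : ASC V) :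
    TopologicalSpace (OrdRealization K) := instTopologicalSpaceQuot

section

open Set Topology Filter

/-- The unit cube in `Fin d → ℝ`. -/
abbrev unitCube (d : ℕ) : Set (Fin d → ℝ) := Icc 0 1

/-- The boundary of the unit cube. -/
def cubeBd (d : ℕ) : Set (Fin d → ℝ) := {x | x ∈ unitCube d ∧ ∃ i, x i = 0 ∨ x i = 1}

theorem cubeBd_subset (d : ℕ) : cubeBd d ⊆ unitCube d := fun _ h => h.1

theorem isClosed_cubeBd (d : ℕ) : IsClosed (cubeBd d) := by
  have : cubeBd d = unitCube d ∩ ⋃ i, ({x | x i = 0} ∪ {x | x i = 1}) := by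
    ext x; simp [cubeBd]
  rw [this]
  refine isClosed_Icc.inter (isClosed_iUnion_of_finite fun i => ?_)
  exact (isClosed_eq (continuous_apply i) continuous_const).union
    (isClosed_eq (continuous_apply i) continuous_const)

theorem isCompact_cubeBd (d : ℕ) : IsCompact (cubeBd d) :=
  isCompact_Icc.of_isClosed_subset (isClosed_cubeBd d) (cubeBd_subset d)

/-- The sup norm distance to the center of the unit cube, scaled to be `1` on the boundary. -/
noncomputable def cubeRadius {d : ℕ} (x : Fin d → ℝ) : ℝ := ‖fun i => 2 * x i - 1‖

theorem continuous_cubeRadius {d : ℕ} : Continuous (cubeRadius (d := d)) := by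
  unfold cubeRadius; fun_prop

theorem mem_unitCube_iff {d : ℕ} {x : Fin d → ℝ} :
    x ∈ unitCube d ↔ ∀ i, 0 ≤ x i ∧ x i ≤ 1 := by
  simp [unitCube, Pi.le_def, forall_and]

theorem cubeRadius_le_one_iff {d : ℕ} {x : Fin d → ℝ} : cubeRadius x ≤ 1 ↔ x ∈ unitCube d := by
  rw [cubeRadius, pi_norm_le_iff_of_nonneg zero_le_one, mem_unitCube_iff]
  refine forall_congr' fun i => ?_
  rw [Real.norm_eq_abs, abs_le]
  constructor <;> rintro ⟨h, h'⟩ <;> constructor <;> linarith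

theorem mem_cubeBd_of_cubeRadius {d : ℕ} {x : Fin d → ℝ} (h : cubeRadius x = 1) :
    x ∈ cubeBd d := by
  refine ⟨cubeRadius_le_one_iff.1 h.le, ?_⟩
  have hx := mem_unitCube_iff.1 (cubeRadius_le_one_iff.1 h.le)
  by_contra! hc
  refine h.not_lt ((pi_norm_lt_iff zero_lt_one).2 fun i => ?_)
  rw [Real.norm_eq_abs, abs_lt]
  have h0 := lt_of_le_of_ne (hx i).1 (Ne.symm (hc i).1)
  have h1 := lt_of_le_of_ne (hx i).2 (hc i).2
  constructor <;> linarith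

theorem cubeRadius_of_mem_cubeBd {d : ℕ} {x : Fin d → ℝ} (h : x ∈ cubeBd d) :
    cubeRadius x = 1 := by
  refine le_antisymm (cubeRadius_le_one_iff.2 h.1) ?_
  obtain ⟨i, hi⟩ := h.2
  refine le_trans ?_ (norm_le_pi_norm (fun i => 2 * x i - 1) i)
  rcases hi with hi | hi <;> (simp [hi]; try norm_num)

/-- The part `cube × {0} ∪ ∂cube × [0, 1]` of the boundary of the prism over a cube. -/
def openBox (d : ℕ) : Set ((Fin d → ℝ) × ℝ) :=
  {p | p.1 ∈ unitCube d ∧ p.2 ∈ Icc (0 : ℝ) 1 ∧ (p.2 = 0 ∨ p.1 ∈ cubeBd d)}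

/-- The retraction of the prism over a cube onto `openBox`, by projection from a point. -/
theorem exists_retraction_openBox (d : ℕ) :
    ∃ r : (Fin d → ℝ) × ℝ → (Fin d → ℝ) × ℝ, Continuous r ∧
      MapsTo r (unitCube d ×ˢ Icc (0 : ℝ) 1) (openBox d) ∧ ∀ p ∈ openBox d, r p = p := by
  let s : (Fin d → ℝ) × ℝ → ℝ := fun p => max (max (cubeRadius p.1) (1 - p.2 / 2)) (1 / 2)
  have hs : Continuous s := by
    have := continuous_cubeRadius (d := d)
    fun_prop
  have hs0 : ∀ p, s p ≠ 0 := fun p => (lt_of_lt_of_le (by norm_num) (le_max_right _ _)).ne'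
  refine ⟨fun p => (fun i => 1 / 2 + (p.1 i - 1 / 2) / s p, 2 - (2 - p.2) / s p), ?_, ?_, ?_⟩
  · refine Continuous.prodMk (continuous_pi fun i => ?_) ?_
    · exact continuous_const.add (Continuous.div (by fun_prop) hs hs0)
    · exact continuous_const.sub (Continuous.div (by fun_prop) hs hs0)
  · rintro ⟨x, t⟩ ⟨hx, ht0, ht1⟩
    simp only at hx ht0 ht1
    have hr := cubeRadius_le_one_iff.2 hx
    have hsp : s (x, t) = max (cubeRadius x) (1 - t / 2) :=
      max_eq_left (le_max_of_le_right (by simp only; linarith))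
    have hpos : 0 < s (x, t) := lt_of_le_of_ne
      (le_trans (by norm_num) (le_max_right _ _)) (hs0 _).symm
    have hs1 : s (x, t) ≤ 1 := by rw [hsp]; exact max_le hr (by linarith)
    have hst : 1 - t / 2 ≤ s (x, t) := by rw [hsp]; exact le_max_right _ _
    have hsr : cubeRadius x ≤ s (x, t) := by rw [hsp]; exact le_max_left _ _
    have hrad : cubeRadius (fun i => 1 / 2 + (x i - 1 / 2) / s (x, t)) =
        cubeRadius x / s (x, t) := by
      have : (fun i => 2 * (1 / 2 + (x i - 1 / 2) / s (x, t)) - 1) =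
          (s (x, t))⁻¹ • fun i => 2 * x i - 1 := by
        ext i; simp only [Pi.smul_apply, smul_eq_mul]; field_simp; ring
      rw [cubeRadius, this, norm_smul, norm_inv, Real.norm_of_nonneg hpos.le, cubeRadius]
      ring
    refine ⟨?_, ⟨?_, ?_⟩, ?_⟩
    · rw [← cubeRadius_le_one_iff, hrad]; exact (div_le_one hpos).2 hsr
    · have : (2 - t) / s (x, t) ≤ 2 := by rw [div_le_iff₀ hpos]; linarith
      simp only; linarith
    · have : 1 ≤ (2 - t) / s (x, t) := by rw [le_div_iff₀ hpos]; linarith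
      simp only; linarith
    · rcases max_choice (cubeRadius x) (1 - t / 2) with h | h
      · right
        apply mem_cubeBd_of_cubeRadius
        rw [hrad, hsp.trans h, div_self]
        rw [← h, ← hsp]; exact hpos.ne'
      · left
        simp only
        rw [hsp.trans h, sub_eq_zero, eq_div_iff (by linarith)]
        ring
  · rintro ⟨x, t⟩ ⟨hx, ⟨ht0, ht1⟩, h⟩
    simp only at hx ht0 ht1 h
    have hr := cubeRadius_le_one_iff.2 hx
    have hsp : s (x, t) = 1 := by
      refine le_antisymm (max_le (max_le hr (by simp only; linarith)) (by norm_num)) ?_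
      refine le_trans ?_ (le_max_left _ _)
      rcases h with h | h
      · exact le_max_of_le_right (by simp [h])
      · exact le_max_of_le_left (cubeRadius_of_mem_cubeBd h).ge
    ext <;> simp [hsp]

variable {X Y : Type*} [TopologicalSpace X] [TopologicalSpace Y]

theorem homotopy_extension {d : ℕ} (F : (Fin d → ℝ) × ℝ → X) (hF : ContinuousOn F (openBox d)) :
    ∃ G : (Fin d → ℝ) × ℝ → X, ContinuousOn G (unitCube d ×ˢ Icc (0 : ℝ) 1) ∧
      EqOn G F (openBox d) ∧
      MapsTo G (unitCube d ×ˢ Icc (0 : ℝ) 1) (F '' openBox d) := by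
  obtain ⟨r, hr, hm, he⟩ := exists_retraction_openBox d
  exact ⟨F ∘ r, hF.comp hr.continuousOn hm, fun p hp => congrArg F (he p hp),
    fun p hp => mem_image_of_mem _ (hm hp)⟩

/-- Maps from the boundary of the `d`-cube to `A` extend over the cube. -/
def CubeExt (A : Set X) (d : ℕ) : Prop :=
  ∀ g : (Fin d → ℝ) → X, ContinuousOn g (cubeBd d) → MapsTo g (cubeBd d) A →
    ∃ g', ContinuousOn g' (unitCube d) ∧ MapsTo g' (unitCube d) A ∧ EqOn g' g (cubeBd d)

theorem openBox_eq (d : ℕ) :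
    openBox d = unitCube d ×ˢ {0} ∪ cubeBd d ×ˢ Icc (0 : ℝ) 1 := by
  ext ⟨x, t⟩
  simp only [openBox, mem_ofPred_eq, mem_union, mem_prod, mem_singleton_iff]
  constructor
  · rintro ⟨h1, h2, h3 | h3⟩
    · exact Or.inl ⟨h1, h3⟩
    · exact Or.inr ⟨h3, h2⟩
  · rintro (⟨h1, rfl⟩ | ⟨h1, h2⟩)
    · exact ⟨h1, by simp, Or.inl rfl⟩
    · exact ⟨h1.1, h2, Or.inr h1⟩

/-- The homotopy extension property of the boundary of a cube. -/
theorem extend_homotopy {d : ℕ} {A : Set X} {H : (Fin d → ℝ) × ℝ → X} {g : (Fin d → ℝ) → X}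
    (hH : ContinuousOn H (cubeBd d ×ˢ Icc (0 : ℝ) 1))
    (hHA : MapsTo H (cubeBd d ×ˢ Icc (0 : ℝ) 1) A)
    (hg : ContinuousOn g (unitCube d)) (hgA : MapsTo g (unitCube d) A)
    (h0 : ∀ x ∈ cubeBd d, H (x, 0) = g x) :
    ∃ G : (Fin d → ℝ) × ℝ → X, ContinuousOn G (unitCube d ×ˢ Icc (0 : ℝ) 1) ∧
      MapsTo G (unitCube d ×ˢ Icc (0 : ℝ) 1) A ∧ (∀ x ∈ unitCube d, G (x, 0) = g x) ∧
      EqOn G H (cubeBd d ×ˢ Icc (0 : ℝ) 1) := by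
  classical
  let F : (Fin d → ℝ) × ℝ → X := fun p => if p.2 = 0 then g p.1 else H p
  have e1 : EqOn F (fun p => g p.1) (unitCube d ×ˢ {0}) := by
    rintro ⟨x, t⟩ ⟨-, ht⟩; simp only [mem_singleton_iff] at ht; simp [F, ht]
  have e2 : EqOn F H (cubeBd d ×ˢ Icc (0 : ℝ) 1) := by
    rintro ⟨x, t⟩ ⟨hx, -⟩
    by_cases ht : t = 0
    · subst ht; simp [F, h0 x hx]
    · simp [F, ht]
  have hF : ContinuousOn F (openBox d) := by
    rw [openBox_eq]
    refine ContinuousOn.union_of_isClosed ?_ ?_ (isClosed_Icc.prod isClosed_singleton)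
      ((isClosed_cubeBd d).prod isClosed_Icc)
    · refine ContinuousOn.congr ?_ e1
      exact hg.comp continuous_fst.continuousOn fun p hp => hp.1
    · exact hH.congr e2
  have hFA : MapsTo F (openBox d) A := by
    rw [openBox_eq]
    rintro p (hp | hp)
    · rw [e1 hp]; exact hgA hp.1
    · rw [e2 hp]; exact hHA hp
  obtain ⟨G, hG, hGF, hGm⟩ := homotopy_extension F hF
  refine ⟨G, hG, fun p hp => ?_, fun x hx => ?_, fun p hp => ?_⟩
  · obtain ⟨q, hq, e⟩ := hGm hp
    rw [← e]; exact hFA hq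
  · have hm : (x, (0 : ℝ)) ∈ unitCube d ×ˢ {(0 : ℝ)} := ⟨hx, rfl⟩
    rw [hGF (openBox_eq d ▸ Or.inl hm), e1 hm]
  · rw [hGF (openBox_eq d ▸ Or.inr hp), e2 hp]

/-- Extendability over the cube only depends on the homotopy class. -/
theorem extend_of_homotopy {d : ℕ} {A : Set X} {H : (Fin d → ℝ) × ℝ → X} {g : (Fin d → ℝ) → X}
    (hH : ContinuousOn H (cubeBd d ×ˢ Icc (0 : ℝ) 1))
    (hHA : MapsTo H (cubeBd d ×ˢ Icc (0 : ℝ) 1) A)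
    (hg : ContinuousOn g (unitCube d)) (hgA : MapsTo g (unitCube d) A)
    (h0 : ∀ x ∈ cubeBd d, H (x, 0) = g x) :
    ∃ g', ContinuousOn g' (unitCube d) ∧ MapsTo g' (unitCube d) A ∧
      ∀ x ∈ cubeBd d, g' x = H (x, 1) := by
  obtain ⟨G, hG, hGA, -, hGH⟩ := extend_homotopy hH hHA hg hgA h0
  exact ⟨fun x => G (x, 1), hG.comp (by fun_prop) fun x hx => ⟨hx, by simp⟩,
    fun x hx => hGA ⟨hx, by simp⟩, fun x hx => hGH ⟨hx, by simp⟩⟩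

/-- A set that contracts to a point satisfies all extension properties. -/
theorem cubeExt_of_contraction {A : Set X} (H : X × ℝ → X) (c : X) (hc : c ∈ A)
    (hH : ContinuousOn H (A ×ˢ Icc (0 : ℝ) 1)) (hm : MapsTo H (A ×ˢ Icc (0 : ℝ) 1) A)
    (h0 : ∀ x ∈ A, H (x, 0) = x) (h1 : ∀ x ∈ A, H (x, 1) = c) (d : ℕ) : CubeExt A d := by
  intro g hg hgA
  have := extend_of_homotopy (d := d) (A := A) (H := fun p => H (g p.1, 1 - p.2))
    (g := fun _ => c) ?_ ?_ continuousOn_const (fun _ _ => hc) ?_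
  · obtain ⟨g', h1, h2, h3⟩ := this
    refine ⟨g', h1, h2, fun x hx => ?_⟩
    rw [h3 x hx]; simp [h0 _ (hgA hx)]
  · refine hH.comp (ContinuousOn.prodMk (hg.comp continuous_fst.continuousOn fun p hp => hp.1)
      (by fun_prop)) ?_
    rintro ⟨x, t⟩ ⟨hx, ht⟩
    simp only [mem_Icc] at ht
    exact ⟨hgA hx, by simp only [mem_Icc]; constructor <;> linarith⟩
  · rintro ⟨x, t⟩ ⟨hx, ht⟩
    simp only [mem_Icc] at ht
    exact hm ⟨hgA hx, by simp only [mem_Icc]; constructor <;> linarith⟩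
  · intro x hx; simp [h1 _ (hgA hx)]

/-- The boundary of the prism over a cube. -/
def prismBd (d : ℕ) : Set ((Fin d → ℝ) × ℝ) :=
  {p | p.1 ∈ unitCube d ∧ p.2 ∈ Icc (0 : ℝ) 1 ∧ (p.2 = 0 ∨ p.2 = 1 ∨ p.1 ∈ cubeBd d)}

theorem cons_mem_unitCube {d : ℕ} {x : Fin d → ℝ} {t : ℝ} :
    (Fin.cons t x : Fin (d + 1) → ℝ) ∈ unitCube (d + 1) ↔ x ∈ unitCube d ∧ t ∈ Icc (0 : ℝ) 1 := by
  rw [mem_unitCube_iff, mem_unitCube_iff, Fin.forall_fin_succ]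
  simp only [Fin.cons_zero, Fin.cons_succ, mem_Icc]
  tauto

theorem cons_mem_cubeBd {d : ℕ} {x : Fin d → ℝ} {t : ℝ} :
    (Fin.cons t x : Fin (d + 1) → ℝ) ∈ cubeBd (d + 1) ↔ (x, t) ∈ prismBd d := by
  simp only [cubeBd, prismBd, mem_ofPred_eq, cons_mem_unitCube, Fin.exists_fin_succ, Fin.cons_zero,
    Fin.cons_succ]
  by_cases h : x ∈ unitCube d <;> simp [h, or_assoc]

theorem continuous_cons {d : ℕ} :
    Continuous fun p : (Fin d → ℝ) × ℝ => (Fin.cons p.2 p.1 : Fin (d + 1) → ℝ) := by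
  refine continuous_pi fun i => ?_
  refine Fin.cases ?_ (fun i => ?_) i
  · simpa using continuous_snd
  · simp only [Fin.cons_succ]; fun_prop

theorem CubeExt.prism {A : Set X} {d : ℕ} (h : CubeExt A (d + 1)) (F : (Fin d → ℝ) × ℝ → X)
    (hF : ContinuousOn F (prismBd d)) (hA : MapsTo F (prismBd d) A) :
    ∃ G : (Fin d → ℝ) × ℝ → X, ContinuousOn G (unitCube d ×ˢ Icc (0 : ℝ) 1) ∧
      MapsTo G (unitCube d ×ˢ Icc (0 : ℝ) 1) A ∧ EqOn G F (prismBd d) := by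
  have hc : ∀ x : Fin (d + 1) → ℝ, x = Fin.cons (x 0) (Fin.tail x) := fun x =>
    (Fin.cons_self_tail x).symm
  have hm : MapsTo (fun x : Fin (d + 1) → ℝ => (Fin.tail x, x 0)) (cubeBd (d + 1)) (prismBd d) := by
    intro x hx; rw [hc x] at hx; exact cons_mem_cubeBd.1 hx
  have ht : Continuous fun x : Fin (d + 1) → ℝ => (Fin.tail x, x 0) := by
    unfold Fin.tail; fun_prop
  obtain ⟨g, h1, h2, h3⟩ := h (fun x => F (Fin.tail x, x 0)) (hF.comp ht.continuousOn hm)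
    fun x hx => hA (hm hx)
  refine ⟨fun p => g (Fin.cons p.2 p.1), h1.comp continuous_cons.continuousOn ?_, ?_, ?_⟩
  · rintro ⟨x, t⟩ hp; exact cons_mem_unitCube.2 hp
  · rintro ⟨x, t⟩ hp; exact h2 (cons_mem_unitCube.2 hp)
  · rintro ⟨x, t⟩ hp
    have := h3 (cons_mem_cubeBd.2 hp)
    simpa using this

/-- The closed cell of the cubical grid of mesh `1 / N` with lowest corner `c / N` and edge
directions `S`. -/
def gridCell {m : ℕ} (N : ℕ) (c : Fin m → ℤ) (S : Finset (Fin m)) : Set (Fin m → ℝ) :=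
  {x | ∀ i, (c i : ℝ) ≤ N * x i ∧ N * x i ≤ c i + if i ∈ S then 1 else 0}

/-- The boundary of a grid cell. -/
def gridBd {m : ℕ} (N : ℕ) (c : Fin m → ℤ) (S : Finset (Fin m)) : Set (Fin m → ℝ) :=
  {x | x ∈ gridCell N c S ∧ ∃ i ∈ S, N * x i = c i ∨ N * x i = c i + 1}

section Grid

variable {m N : ℕ} {c c' : Fin m → ℤ} {S S' : Finset (Fin m)} {x y : Fin m → ℝ}

theorem gridBd_subset : gridBd N c S ⊆ gridCell N c S := fun _ h => h.1

theorem isClosed_gridCell : IsClosed (gridCell N c S) := by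
  have : gridCell N c S = ⋂ i, {x | (c i : ℝ) ≤ N * x i} ∩
      {x | N * x i ≤ c i + if i ∈ S then (1 : ℝ) else 0} := by
    ext x; simp [gridCell]
  rw [this]
  exact isClosed_iInter fun i => (isClosed_le (by fun_prop) (by fun_prop)).inter
    (isClosed_le (by fun_prop) (by fun_prop))

theorem gridCell_coord_eq (hx : x ∈ gridCell N c S) {i : Fin m} (hi : i ∉ S) : N * x i = c i := by
  have := hx i
  simp only [hi, if_false] at this
  linarith

theorem gridCell_coord_le (hx : x ∈ gridCell N c S) (i : Fin m) : N * x i ≤ c i + 1 := by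
  refine (hx i).2.trans ?_
  split_ifs <;> simp

theorem dist_le_of_mem_gridCell (hN : 0 < N) (hx : x ∈ gridCell N c S) (hy : y ∈ gridCell N c S) :
    dist x y ≤ 1 / N := by
  have hN' : (0 : ℝ) < N := by exact_mod_cast hN
  refine (dist_pi_le_iff (by positivity)).2 fun i => ?_
  have h : |x i - y i| * N = |N * x i - N * y i| := by
    rw [← mul_sub, abs_mul, abs_of_pos hN', mul_comm]
  rw [Real.dist_eq, le_div_iff₀ hN', h, abs_le]
  have h1 := (hx i).1
  have h2 := (hy i).1
  have h3 := gridCell_coord_le hx i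
  have h4 := gridCell_coord_le hy i
  constructor <;> linarith

theorem gridCell_low_mem (hN : 0 < N) : (fun i => (c i : ℝ) / N) ∈ gridCell N c S := by
  have hN' : (0 : ℝ) < N := by exact_mod_cast hN
  intro i
  rw [mul_div_cancel₀ _ hN'.ne']
  split_ifs <;> simp

theorem gridCell_high_mem (hN : 0 < N) :
    (fun i => ((c i : ℝ) + if i ∈ S then 1 else 0) / N) ∈ gridCell N c S := by
  have hN' : (0 : ℝ) < N := by exact_mod_cast hN
  intro i
  rw [mul_div_cancel₀ _ hN'.ne']
  split_ifs <;> simp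

/-- Distinct cells of a grid meet in the boundary of the larger one. -/
theorem mem_gridBd_of_mem (hx : x ∈ gridCell N c S) (hx' : x ∈ gridCell N c' S')
    (hS : S'.card ≤ S.card) (hne : (c', S') ≠ (c, S)) : x ∈ gridBd N c S := by
  by_contra hb
  have hcoord : ∀ i ∈ S, (c i : ℝ) < N * x i ∧ N * x i < c i + 1 := by
    intro i hi
    have hb' : ¬ ∃ i ∈ S, N * x i = c i ∨ N * x i = c i + 1 := fun h => hb ⟨hx, h⟩
    push Not at hb'
    have := hx i
    simp only [hi, if_true] at this
    exact ⟨lt_of_le_of_ne this.1 (hb' i hi).1.symm, lt_of_le_of_ne this.2 (hb' i hi).2⟩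
  have hsub : S ⊆ S' := by
    intro i hi
    by_contra hi'
    have h1 := gridCell_coord_eq hx' hi'
    have h2 := hcoord i hi
    rw [h1] at h2
    norm_cast at h2
    omega
  have hSS : S = S' := Finset.eq_of_subset_of_card_le hsub hS
  subst hSS
  refine hne (Prod.ext (funext fun i => ?_) rfl)
  by_cases hi : i ∈ S
  · have h1 := hx' i
    have h2 := hcoord i hi
    simp only [hi, if_true] at h1
    have a1 : (c i : ℝ) < c' i + 1 := by linarith
    have a2 : (c' i : ℝ) < c i + 1 := by linarith
    norm_cast at a1 a2
    simp only
    omega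
  · have h1 := gridCell_coord_eq hx hi
    rw [gridCell_coord_eq hx' hi] at h1
    exact_mod_cast h1

/-- The boundary of a cell is a union of smaller cells. -/
theorem exists_face_of_mem_gridBd (hx : x ∈ gridBd N c S) :
    ∃ (c' : Fin m → ℤ) (S' : Finset (Fin m)), S'.card < S.card ∧ x ∈ gridCell N c' S' ∧
      gridCell N c' S' ⊆ gridBd N c S := by
  obtain ⟨hx, i, hi, h⟩ := hx
  obtain ⟨a, ha, ha'⟩ : ∃ a : ℤ, N * x i = a ∧ (a = c i ∨ a = c i + 1) := by
    rcases h with h | h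
    · exact ⟨c i, h, Or.inl rfl⟩
    · exact ⟨c i + 1, by push_cast; exact h, Or.inr rfl⟩
  refine ⟨Function.update c i a, S.erase i, Finset.card_erase_lt_of_mem hi, fun j => ?_,
    fun y hy => ⟨fun j => ?_, i, hi, ?_⟩⟩
  · by_cases hj : j = i
    · subst hj; simp [ha]
    · simpa [hj] using hx j
  · by_cases hj : j = i
    · subst hj
      have := hy j
      simp at this
      have e : N * y j = a := by linarith
      rw [e]
      rcases ha' with rfl | rfl <;> simp [hi]
    · simpa [hj] using hy j
  · have := hy i
    simp at this
    have e : N * y i = a := by linarith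
    rw [e]
    rcases ha' with rfl | rfl <;> simp

/-- A cell is a union of cells of the same dimension in any refined grid. -/
theorem exists_refined_cell {q : ℕ} (hq : 0 < q) (hx : x ∈ gridCell N c S) :
    ∃ c' : Fin m → ℤ, x ∈ gridCell (N * q) c' S ∧ gridCell (N * q) c' S ⊆ gridCell N c S ∧
      (fun i => c' i / q) = c := by
  have hq' : (0 : ℝ) < q := by exact_mod_cast hq
  have hqz : (0 : ℤ) < q := by exact_mod_cast hq
  let c' : Fin m → ℤ := fun i =>
    if i ∈ S then min ⌊(N * q : ℝ) * x i⌋ (q * (c i + 1) - 1) else q * c i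
  have hlow : ∀ i, q * c i ≤ c' i := by
    intro i
    by_cases hi : i ∈ S
    · simp only [c', hi, if_true]
      refine le_min (Int.le_floor.2 ?_) (by nlinarith)
      push_cast
      nlinarith [(hx i).1]
    · simp [c', hi]
  have hup : ∀ i, c' i ≤ q * (c i + 1) - 1 := by
    intro i
    by_cases hi : i ∈ S
    · simp only [c', hi, if_true]
      exact min_le_right _ _
    · simp only [c', hi, if_false]; nlinarith
  refine ⟨c', fun i => ?_, fun y hy i => ?_, funext fun i => ?_⟩
  · push_cast
    by_cases hi : i ∈ S
    · have h2 := gridCell_coord_le hx i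
      simp only [c', hi, if_true]
      constructor
      · exact le_trans (by exact_mod_cast min_le_left _ _) (Int.floor_le _)
      · rcases min_choice ⌊(N * q : ℝ) * x i⌋ (q * (c i + 1) - 1) with h | h
        · rw [h]; exact (Int.lt_floor_add_one _).le
        · rw [h]; push_cast; nlinarith
    · have h2 := gridCell_coord_eq hx hi
      simp only [c', hi, if_false]
      push_cast
      constructor <;> nlinarith
  · have h1 := hy i
    push_cast at h1
    by_cases hi : i ∈ S
    · simp only [hi, if_true] at h1 ⊢
      have a1 : ((q * c i : ℤ) : ℝ) ≤ c' i := by exact_mod_cast hlow i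
      have a2 : (c' i : ℝ) ≤ ((q * (c i + 1) - 1 : ℤ) : ℝ) := by exact_mod_cast hup i
      push_cast at a1 a2
      constructor
      · refine le_of_mul_le_mul_left ?_ hq'; linarith
      · refine le_of_mul_le_mul_left ?_ hq'; linarith
    · simp only [hi, if_false, c'] at h1 ⊢
      push_cast at h1
      constructor
      · refine le_of_mul_le_mul_left ?_ hq'; linarith
      · refine le_of_mul_le_mul_left ?_ hq'; linarith
  · have h1 := hlow i
    have h2 := hup i
    refine le_antisymm (Int.lt_add_one_iff.1 (Int.ediv_lt_of_lt_mul hqz ?_))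
      (Int.le_ediv_of_mul_le hqz ?_) <;> linarith

theorem finite_gridCells (hN : 0 < N) :
    {p : (Fin m → ℤ) × Finset (Fin m) | gridCell N p.1 p.2 ⊆ unitCube m}.Finite := by
  refine ((Set.finite_Icc (0 : Fin m → ℤ) (fun _ => N)).prod (Set.toFinite univ)).subset ?_
  rintro ⟨c, S⟩ hp
  have h := mem_unitCube_iff.1 (hp (gridCell_low_mem hN))
  have hN' : (0 : ℝ) < N := by exact_mod_cast hN
  refine ⟨⟨fun i => ?_, fun i => ?_⟩, mem_univ _⟩
  · have := (h i).1
    rw [le_div_iff₀ hN', zero_mul] at this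
    exact_mod_cast this
  · have := (h i).2
    rw [div_le_iff₀ hN', one_mul] at this
    exact_mod_cast this

/-- The cube with one face. -/
theorem gridCell_subset_cubeBd_or (hN : 0 < N) (hc : gridCell N c S ⊆ unitCube m) :
    gridCell N c S ⊆ cubeBd m ∨ gridCell N c S ∩ cubeBd m ⊆ gridBd N c S := by
  have hN' : (0 : ℝ) < N := by exact_mod_cast hN
  by_cases h : gridCell N c S ⊆ cubeBd m
  · exact Or.inl h
  refine Or.inr ?_
  rintro x ⟨hx, -, i, hi⟩
  have hS : i ∈ S := by
    by_contra hS
    refine h fun y hy => ⟨hc hy, i, ?_⟩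
    have : y i = x i := by
      have := gridCell_coord_eq hx hS
      rw [← gridCell_coord_eq hy hS] at this
      exact (mul_left_cancel₀ hN'.ne' this).symm
    rwa [this]
  refine ⟨hx, i, hS, ?_⟩
  have h1 := hx i
  simp only [hS, if_true] at h1
  rcases hi with hi | hi
  · left
    have := (mem_unitCube_iff.1 (hc (gridCell_low_mem hN)) i).1
    rw [le_div_iff₀ hN', zero_mul] at this
    rw [hi] at h1 ⊢
    linarith
  · right
    have := (mem_unitCube_iff.1 (hc (gridCell_high_mem hN)) i).2
    simp only [hS, if_true] at this
    rw [div_le_iff₀ hN', one_mul] at this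
    rw [hi] at h1 ⊢
    linarith

theorem gridCell_one_univ : gridCell 1 (0 : Fin m → ℤ) Finset.univ = unitCube m := by
  ext x; rw [mem_unitCube_iff]; simp [gridCell]

theorem exists_gridCell_of_mem_cubeBd (hx : x ∈ cubeBd m) :
    ∃ (c : Fin m → ℤ) (S : Finset (Fin m)), S.card < m ∧ x ∈ gridCell 1 c S ∧
      gridCell 1 c S ⊆ cubeBd m := by
  have h : cubeBd m = gridBd 1 0 Finset.univ := by
    ext x
    simp [gridBd, gridCell_one_univ, cubeBd]
  rw [h] at hx ⊢
  obtain ⟨c', S', h1, h2, h3⟩ := exists_face_of_mem_gridBd hx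
  exact ⟨c', S', by simpa using h1, h2, h3⟩

end Grid

end

section

open Set Topology Filter

variable {B T : Type*} [TopologicalSpace B] [TopologicalSpace T]

/-- Lifts along `e` of maps from the `d`-cube to `U` extend from the boundary to the cube,
with values in `Φ`. -/
def LocalExt (e : T → B) (U : Set B) (Φ : Set T) (d : ℕ) : Prop :=
  ∀ (u : (Fin d → ℝ) → B) (v : (Fin d → ℝ) → T), ContinuousOn u (unitCube d) →
    MapsTo u (unitCube d) U → ContinuousOn v (cubeBd d) → MapsTo v (cubeBd d) Φ →
    (∀ x ∈ cubeBd d, e (v x) = u x) →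
    ∃ v' : (Fin d → ℝ) → T, ContinuousOn v' (unitCube d) ∧ MapsTo v' (unitCube d) Φ ∧
      EqOn v' v (cubeBd d) ∧ ∀ x ∈ unitCube d, e (v' x) = u x

theorem exists_gridCell_coordinates {m N : ℕ} (hN : 0 < N) (c : Fin m → ℤ) (S : Finset (Fin m)) :
    ∃ (α : (Fin S.card → ℝ) → Fin m → ℝ) (β : (Fin m → ℝ) → Fin S.card → ℝ),
      Continuous α ∧ Continuous β ∧ MapsTo α (unitCube S.card) (gridCell N c S) ∧
      MapsTo α (cubeBd S.card) (gridBd N c S) ∧ MapsTo β (gridCell N c S) (unitCube S.card) ∧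
      MapsTo β (gridBd N c S) (cubeBd S.card) ∧ ∀ x ∈ gridCell N c S, α (β x) = x := by
  have hN' : (0 : ℝ) < N := by exact_mod_cast hN
  let φ := S.equivFin
  let α : (Fin S.card → ℝ) → Fin m → ℝ := fun y i =>
    (c i + if h : i ∈ S then y (φ ⟨i, h⟩) else 0) / N
  let β : (Fin m → ℝ) → Fin S.card → ℝ := fun x j => N * x (φ.symm j) - c (φ.symm j)
  have hα1 : ∀ y i (h : i ∈ S), N * α y i = c i + y (φ ⟨i, h⟩) := by
    intro y i h; simp only [α, h, dif_pos]; field_simp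
  have hα0 : ∀ y i, i ∉ S → N * α y i = c i := by
    intro y i h; simp only [α, h, dif_neg, not_false_eq_true]; field_simp; ring
  have hα : MapsTo α (unitCube S.card) (gridCell N c S) := by
    intro y hy i
    rw [mem_unitCube_iff] at hy
    by_cases h : i ∈ S
    · rw [hα1 y i h]
      have := hy (φ ⟨i, h⟩)
      simp only [h, if_true]
      constructor <;> linarith
    · rw [hα0 y i h]; simp [h]
  have hβ : MapsTo β (gridCell N c S) (unitCube S.card) := by
    intro x hx
    rw [mem_unitCube_iff]
    intro j
    have h1 := (hx (φ.symm j)).1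
    have h2 := gridCell_coord_le hx (φ.symm j)
    simp only [β]
    constructor <;> linarith
  refine ⟨α, β, ?_, by fun_prop, hα, ?_, hβ, ?_, ?_⟩
  · refine continuous_pi fun i => ?_
    by_cases h : i ∈ S
    · simp only [α, h, dif_pos]; fun_prop
    · simp only [α, h, dif_neg, not_false_eq_true]; fun_prop
  · rintro y ⟨hy, j, hj⟩
    refine ⟨hα hy, φ.symm j, (φ.symm j).2, ?_⟩
    rw [hα1 y _ (φ.symm j).2]
    rcases hj with hj | hj <;> simp [hj]
  · rintro x ⟨hx, i, hi, h⟩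
    refine ⟨hβ hx, φ ⟨i, hi⟩, ?_⟩
    rcases h with h | h <;> simp [β, h]
  · intro x hx
    ext i
    by_cases h : i ∈ S
    · simp only [α, β, h, dif_pos, Equiv.symm_apply_apply]; field_simp; ring
    · have := gridCell_coord_eq hx h
      simp only [α, h, dif_neg, not_false_eq_true]
      rw [← this]; field_simp; ring

theorem LocalExt.gridCell {e : T → B} {U : Set B} {Φ : Set T} {m N : ℕ} (hN : 0 < N)
    {c : Fin m → ℤ} {S : Finset (Fin m)} (h : LocalExt e U Φ S.card)
    {u : (Fin m → ℝ) → B} {v : (Fin m → ℝ) → T} (hu : ContinuousOn u (gridCell N c S))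
    (hU : MapsTo u (gridCell N c S) U) (hv : ContinuousOn v (gridBd N c S))
    (hΦ : MapsTo v (gridBd N c S) Φ) (he : ∀ x ∈ gridBd N c S, e (v x) = u x) :
    ∃ v' : (Fin m → ℝ) → T, ContinuousOn v' (gridCell N c S) ∧ MapsTo v' (gridCell N c S) Φ ∧
      EqOn v' v (gridBd N c S) ∧ ∀ x ∈ gridCell N c S, e (v' x) = u x := by
  obtain ⟨α, β, hα, hβ, hαm, hαb, hβm, hβb, hαβ⟩ := exists_gridCell_coordinates hN c S
  obtain ⟨v', h1, h2, h3, h4⟩ := h (u ∘ α) (v ∘ α) (hu.comp hα.continuousOn hαm) (hU.comp hαm)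
    (hv.comp hα.continuousOn hαb) (hΦ.comp hαb) fun x hx => he _ (hαb hx)
  refine ⟨v' ∘ β, h1.comp hβ.continuousOn hβm, h2.comp hβm, fun x hx => ?_, fun x hx => ?_⟩
  · have := h3 (hβb hx)
    simp only [Function.comp_apply] at this ⊢
    rw [this, hαβ x hx.1]
  · have := h4 _ (hβm hx)
    simp only [Function.comp_apply] at this ⊢
    rw [this, hαβ x hx]

theorem eventually_mesh {m : ℕ} {K : Set (Fin m → ℝ)} (hK : IsCompact K) {u : (Fin m → ℝ) → B}
    (hu : ContinuousOn u K) {U : B → Set B} (hU : ∀ z, IsOpen (U z))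
    (hself : ∀ x ∈ K, u x ∈ U (u x)) :
    ∀ᶠ q : ℕ in atTop, ∀ x ∈ K, ∃ z ∈ K, ∀ y ∈ K, dist x y ≤ 1 / q → u y ∈ U (u z) := by
  obtain ⟨V, hV, h⟩ := lebesgue_number_lemma_nhdsWithin' (U := fun x _ => u ⁻¹' U (u x)) hK
    fun x hx => hu x hx ((hU _).mem_nhds (hself x hx))
  obtain ⟨δ, hδ, hδV⟩ := Metric.mem_uniformity_dist.1 hV
  obtain ⟨n, hn⟩ := exists_nat_gt (1 / δ)
  filter_upwards [eventually_ge_atTop n] with q hq x hx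
  obtain ⟨z, hz⟩ := h x hx
  refine ⟨z, z.2, fun y hy hxy => hz ⟨hδV (hxy.trans_lt ?_), hy⟩⟩
  have hqδ : 1 / δ < q := hn.trans_le (by exact_mod_cast hq)
  have : (0 : ℝ) < q := lt_trans (by positivity) hqδ
  rw [div_lt_iff₀ this]
  rwa [div_lt_iff₀ hδ, mul_comm] at hqδ

/-- The grid cells of dimension less than `d` inside `R`. -/
def gridCells {m : ℕ} (R : Set (Fin m → ℝ)) (N d : ℕ) :
    Set ((Fin m → ℤ) × Finset (Fin m)) :=
  {p | gridCell N p.1 p.2 ⊆ R ∧ p.2.card < d}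

/-- The union of the grid cells of dimension less than `d` inside `R`. -/
def gridSkel {m : ℕ} (R : Set (Fin m → ℝ)) (N d : ℕ) : Set (Fin m → ℝ) :=
  ⋃ p ∈ gridCells R N d, gridCell N p.1 p.2

theorem gridCell_subset_gridSkel {m : ℕ} {R : Set (Fin m → ℝ)} {N d : ℕ} {p}
    (hp : p ∈ gridCells R N d) : gridCell N p.1 p.2 ⊆ gridSkel R N d :=
  subset_biUnion_of_mem (u := fun p => gridCell N p.1 p.2) hp

theorem finite_gridCells_of_subset {m : ℕ} {R : Set (Fin m → ℝ)} (hR : R ⊆ unitCube m) {N : ℕ}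
    (hN : 0 < N) (d : ℕ) : (gridCells R N d).Finite :=
  (finite_gridCells hN).subset fun _ hp => hp.1.trans hR

theorem isClosed_gridSkel {m : ℕ} {R : Set (Fin m → ℝ)} (hR : R ⊆ unitCube m) {N : ℕ}
    (hN : 0 < N) (d : ℕ) : IsClosed (gridSkel R N d) :=
  (finite_gridCells_of_subset hR hN d).isClosed_biUnion fun _ _ => isClosed_gridCell

end

section

open Set Topology Filter

variable {B T : Type*} [TopologicalSpace B] [TopologicalSpace T]

theorem exists_grid_lift {e : T → B} {U : B → Set B} {Φ : B → Set T} (hU : ∀ z, IsOpen (U z))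
    (hΦ : ∀ z z' t, z' ∈ U z → t ∈ Φ z' → e t ∈ U z → t ∈ Φ z)
    {m k : ℕ} {R L : Set (Fin m → ℝ)} {u : (Fin m → ℝ) → B} {v₀ : (Fin m → ℝ) → T}
    (hR : R ⊆ unitCube m) (hu : ContinuousOn u R) (hself : ∀ x ∈ R, u x ∈ U (u x))
    (hL : IsClosed L) (hv₀ : ContinuousOn v₀ L)
    (hΦ₀ : ∀ x ∈ L, ∀ z, u x ∈ U z → v₀ x ∈ Φ z) (he₀ : ∀ x ∈ L, e (v₀ x) = u x)
    (hcell : ∀ N c S, 0 < N → gridCell N c S ⊆ R →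
      gridCell N c S ⊆ L ∨ gridCell N c S ∩ L ⊆ gridBd N c S)
    (hext : ∀ d < k, ∀ z, LocalExt e (U z) (Φ z) d) {d : ℕ} (hd : d ≤ k) :
    ∀ N : ℕ, 0 < N → ∃ v : (Fin m → ℝ) → T, ContinuousOn v (L ∪ gridSkel R N d) ∧ EqOn v v₀ L ∧
      (∀ x ∈ gridSkel R N d, e (v x) = u x) ∧ (∀ x ∈ gridSkel R N d, ∃ z, v x ∈ Φ z) ∧
      ∀ p ∈ gridCells R N d, ∀ z, MapsTo u (gridCell N p.1 p.2) (U z) →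
        MapsTo v (gridCell N p.1 p.2) (Φ z) := by
  classical
  induction d with
  | zero =>
    intro N _
    have : gridSkel R N 0 = ∅ := by simp [gridSkel, gridCells]
    exact ⟨v₀, by simpa [this] using hv₀, fun _ _ => rfl, by simp [this], by simp [this], by simp [gridCells]⟩
  | succ d ih =>
    intro N hN
    have hmesh : ∀ᶠ q : ℕ in atTop, ∀ p ∈ gridCells R N (d + 1), ∀ x ∈ gridCell N p.1 p.2,
        ∃ z ∈ gridCell N p.1 p.2, ∀ y ∈ gridCell N p.1 p.2, dist x y ≤ 1 / q → u y ∈ U (u z) := by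
      refine (eventually_all_finite (finite_gridCells_of_subset hR hN (d + 1))).2 fun p hp => ?_
      exact eventually_mesh (isCompact_Icc.of_isClosed_subset isClosed_gridCell (hp.1.trans hR))
        (hu.mono hp.1) hU fun x hx => hself x (hp.1 hx)
    obtain ⟨q, hq, hq0⟩ := (hmesh.and (eventually_gt_atTop 0)).exists
    have hM : 0 < N * q := Nat.mul_pos hN hq0
    have hMq : (1 : ℝ) / (N * q : ℕ) ≤ 1 / q := by
      refine one_div_le_one_div_of_le (by exact_mod_cast hq0) ?_
      exact_mod_cast Nat.le_mul_of_pos_left q hN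
    obtain ⟨v, hv, hvL, hve, hvz, hvΦ⟩ := ih (by omega) (N * q) hM
    let par : (Fin m → ℤ) × Finset (Fin m) → (Fin m → ℤ) × Finset (Fin m) :=
      fun p => (fun i => p.1 i / q, p.2)
    let good : Set ((Fin m → ℤ) × Finset (Fin m)) :=
      {p | p.2.card = d ∧ gridCell (N * q) p.1 p.2 ⊆ gridCell N (par p).1 (par p).2 ∧
        gridCell N (par p).1 (par p).2 ⊆ R ∧ ¬ gridCell (N * q) p.1 p.2 ⊆ L}
    have hgR : ∀ p ∈ good, gridCell (N * q) p.1 p.2 ⊆ R := fun p hp => hp.2.1.trans hp.2.2.1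
    have hbd : ∀ p ∈ good, ∀ x ∈ gridBd (N * q) p.1 p.2, ∃ p' ∈ gridCells R (N * q) d,
        x ∈ gridCell (N * q) p'.1 p'.2 ∧
          gridCell (N * q) p'.1 p'.2 ⊆ gridCell (N * q) p.1 p.2 := by
      intro p hp x hx
      obtain ⟨c', S', h1, h2, h3⟩ := exists_face_of_mem_gridBd hx
      have h4 := h3.trans gridBd_subset
      exact ⟨(c', S'), ⟨h4.trans (hgR p hp), by rw [← hp.1]; exact h1⟩, h2, h4⟩
    have key : ∀ p ∈ good, ∃ (w : (Fin m → ℝ) → T) (z : Fin m → ℝ),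
        ContinuousOn w (gridCell (N * q) p.1 p.2) ∧ EqOn w v (gridBd (N * q) p.1 p.2) ∧
        (∀ x ∈ gridCell (N * q) p.1 p.2, e (w x) = u x) ∧
        z ∈ gridCell N (par p).1 (par p).2 ∧ MapsTo w (gridCell (N * q) p.1 p.2) (Φ (u z)) := by
      intro p hp
      obtain ⟨z, hz, hzU⟩ := hq (par p) ⟨hp.2.2.1, by simp only [par]; rw [hp.1]; omega⟩ _
        (hp.2.1 (gridCell_low_mem hM))
      have hzU' : MapsTo u (gridCell (N * q) p.1 p.2) (U (u z)) := fun y hy =>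
        hzU y (hp.2.1 hy) ((dist_le_of_mem_gridCell hM (gridCell_low_mem hM) hy).trans hMq)
      obtain ⟨w, h1, h2, h3, h4⟩ := (hext p.2.card (by rw [hp.1]; omega) (u z)).gridCell hM
        (v := v) (hu.mono (hgR p hp)) hzU'
        (hv.mono fun x hx => by
          obtain ⟨p', hp', hx', -⟩ := hbd p hp x hx
          exact Or.inr (gridCell_subset_gridSkel hp' hx'))
        (fun x hx => by
          obtain ⟨p', hp', hx', hsub⟩ := hbd p hp x hx
          exact hvΦ p' hp' _ (hzU'.mono_left hsub) hx')
        (fun x hx => by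
          obtain ⟨p', hp', hx', -⟩ := hbd p hp x hx
          exact hve x (gridCell_subset_gridSkel hp' hx'))
      exact ⟨w, z, h1, h3, h4, hz, h2⟩
    have : Nonempty T := ⟨v 0⟩
    choose! w z hw hwv hwe hz hwΦ using key
    let v' : (Fin m → ℝ) → T := fun x =>
      if h : ∃ p ∈ good, x ∈ gridCell (N * q) p.1 p.2 then w h.choose x else v x
    have hv'w : ∀ p ∈ good, EqOn v' (w p) (gridCell (N * q) p.1 p.2) := by
      intro p hp x hx
      have h : ∃ p ∈ good, x ∈ gridCell (N * q) p.1 p.2 := ⟨p, hp, hx⟩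
      obtain ⟨h1, h2⟩ := h.choose_spec
      simp only [v', dif_pos h]
      by_cases heq : h.choose = p
      · rw [heq]
      · rw [hwv _ h1 (mem_gridBd_of_mem h2 hx (by rw [hp.1, h1.1]) (Ne.symm heq)),
          hwv _ hp (mem_gridBd_of_mem hx h2 (by rw [hp.1, h1.1]) heq)]
    have hv'v : EqOn v' v (L ∪ gridSkel R (N * q) d) := by
      intro x hx
      by_cases h : ∃ p ∈ good, x ∈ gridCell (N * q) p.1 p.2
      · obtain ⟨p, hp, hxp⟩ := h
        rw [hv'w p hp hxp]
        refine hwv p hp ?_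
        rcases hx with hx | hx
        · exact ((hcell _ _ _ hM (hgR p hp)).resolve_left hp.2.2.2) ⟨hxp, hx⟩
        · simp only [gridSkel, mem_iUnion] at hx
          obtain ⟨p', hp', hx'⟩ := hx
          have hlt : p'.2.card < p.2.card := by rw [hp.1]; exact hp'.2
          refine mem_gridBd_of_mem hxp hx' hlt.le fun h => hlt.ne ?_
          rw [(Prod.ext_iff.1 h).2]
      · simp only [v', dif_neg h]
    have hcover : ∀ p ∈ gridCells R N (d + 1), ∀ x ∈ gridCell N p.1 p.2,
        (∃ p' ∈ gridCells R (N * q) d, x ∈ gridCell (N * q) p'.1 p'.2 ∧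
          gridCell (N * q) p'.1 p'.2 ⊆ gridCell N p.1 p.2) ∨ x ∈ L ∨
        ∃ p' ∈ good, x ∈ gridCell (N * q) p'.1 p'.2 ∧ par p' = p := by
      intro p hp x hx
      obtain ⟨c', h1, h2, h3⟩ := exists_refined_cell hq0 hx
      rcases Nat.lt_succ_iff_lt_or_eq.1 hp.2 with h | h
      · exact Or.inl ⟨(c', p.2), ⟨h2.trans hp.1, h⟩, h1, h2⟩
      by_cases hcL : gridCell (N * q) c' p.2 ⊆ L
      · exact Or.inr (Or.inl (hcL h1))
      · have hpar : par (c', p.2) = p := Prod.ext h3 rfl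
        refine Or.inr (Or.inr ⟨(c', p.2), ⟨h, ?_, ?_, hcL⟩, h1, hpar⟩)
        · rw [hpar]; exact h2
        · rw [hpar]; exact hp.1
    refine ⟨v', ?_, ?_, ?_, ?_, ?_⟩
    · have hgf : good.Finite := (finite_gridCells hM).subset fun p hp => (hgR p hp).trans hR
      have hgc : ContinuousOn v' (⋃ p : good, gridCell (N * q) p.1.1 p.1.2) := by
        have := hgf.to_subtype
        exact (locallyFinite_of_finite _).continuousOn_iUnion (fun p => isClosed_gridCell)
          fun p => (hw p p.2).congr (hv'w p p.2)
      have hgcl : IsClosed (⋃ p : good, gridCell (N * q) p.1.1 p.1.2) := by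
        have := hgf.to_subtype
        exact isClosed_iUnion_of_finite fun p => isClosed_gridCell
      refine ((hv.congr hv'v).union_of_isClosed hgc
        (hL.union (isClosed_gridSkel hR hM d)) hgcl).mono ?_
      rintro x (hx | hx)
      · exact Or.inl (Or.inl hx)
      simp only [gridSkel, mem_iUnion] at hx
      obtain ⟨p, hp, hx⟩ := hx
      rcases hcover p hp x hx with ⟨p', hp', hx', -⟩ | hx' | ⟨p', hp', hx', -⟩
      · exact Or.inl (Or.inr (gridCell_subset_gridSkel hp' hx'))
      · exact Or.inl (Or.inl hx')
      · exact Or.inr (mem_iUnion.2 ⟨⟨p', hp'⟩, hx'⟩)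
    · exact fun x hx => (hv'v (Or.inl hx)).trans (hvL hx)
    · intro x hx
      simp only [gridSkel, mem_iUnion] at hx
      obtain ⟨p, hp, hx⟩ := hx
      rcases hcover p hp x hx with ⟨p', hp', hx', -⟩ | hx' | ⟨p', hp', hx', -⟩
      · have := gridCell_subset_gridSkel hp' hx'
        rw [hv'v (Or.inr this), hve x this]
      · rw [hv'v (Or.inl hx'), hvL hx', he₀ x hx']
      · rw [hv'w p' hp' hx', hwe p' hp' x hx']
    · intro x hx
      simp only [gridSkel, mem_iUnion] at hx
      obtain ⟨p, hp, hx⟩ := hx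
      rcases hcover p hp x hx with ⟨p', hp', hx', -⟩ | hx' | ⟨p', hp', hx', -⟩
      · have := gridCell_subset_gridSkel hp' hx'
        rw [hv'v (Or.inr this)]
        exact hvz x this
      · rw [hv'v (Or.inl hx'), hvL hx']
        exact ⟨u x, hΦ₀ x hx' _ (hself x (hp.1 hx))⟩
      · rw [hv'w p' hp' hx']
        exact ⟨_, hwΦ p' hp' hx'⟩
    · intro p hp z₀ hz₀ x hx
      rcases hcover p hp x hx with ⟨p', hp', hx', hsub⟩ | hx' | ⟨p', hp', hx', hpar⟩
      · rw [hv'v (Or.inr (gridCell_subset_gridSkel hp' hx'))]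
        exact hvΦ p' hp' z₀ (hz₀.mono_left hsub) hx'
      · rw [hv'v (Or.inl hx'), hvL hx']
        exact hΦ₀ x hx' z₀ (hz₀ hx)
      · rw [hv'w p' hp' hx']
        have hzp := hz p' hp'
        rw [hpar] at hzp
        refine hΦ z₀ (u (z p')) _ (hz₀ hzp) (hwΦ p' hp' hx') ?_
        rw [hwe p' hp' x hx']
        exact hz₀ hx

end

section

open Set Topology Filter unitInterval

section Lift

variable {B T : Type*} [TopologicalSpace B] [TopologicalSpace T]

theorem exists_lift_cubeBd [Nonempty T] {e : T → B} {U : B → Set B} {Φ : B → Set T}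
    (hU : ∀ z, IsOpen (U z)) (hΦ : ∀ z z' t, z' ∈ U z → t ∈ Φ z' → e t ∈ U z → t ∈ Φ z)
    {k : ℕ} {u : (Fin k → ℝ) → B} (hu : ContinuousOn u (cubeBd k))
    (hself : ∀ x ∈ cubeBd k, u x ∈ U (u x)) (hext : ∀ d < k, ∀ z, LocalExt e (U z) (Φ z) d) :
    ∃ v : (Fin k → ℝ) → T, ContinuousOn v (cubeBd k) ∧
      ∀ x ∈ cubeBd k, e (v x) = u x ∧ ∃ z, v x ∈ Φ z := by
  obtain ⟨v, h1, -, h2, h3, -⟩ := exists_grid_lift (L := ∅) (v₀ := fun _ => Classical.arbitrary T)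
    hU hΦ (cubeBd_subset k) hu hself isClosed_empty (by simp) (by simp) (by simp)
    (fun _ _ _ _ _ => Or.inr (by simp)) hext le_rfl 1 zero_lt_one
  have hsub : cubeBd k ⊆ gridSkel (cubeBd k) 1 k := by
    intro x hx
    obtain ⟨c, S, h1, h2, h3⟩ := exists_gridCell_of_mem_cubeBd hx
    exact gridCell_subset_gridSkel (p := (c, S)) ⟨h3, h1⟩ h2
  exact ⟨v, h1.mono (hsub.trans subset_union_right), fun x hx => ⟨h2 x (hsub hx), h3 x (hsub hx)⟩⟩

theorem exists_lift_unitCube {e : T → B} {U : B → Set B} {Φ : B → Set T}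
    (hU : ∀ z, IsOpen (U z)) (hΦ : ∀ z z' t, z' ∈ U z → t ∈ Φ z' → e t ∈ U z → t ∈ Φ z)
    {k : ℕ} {u : (Fin k → ℝ) → B} {v₀ : (Fin k → ℝ) → T} (hu : ContinuousOn u (unitCube k))
    (hself : ∀ x ∈ unitCube k, u x ∈ U (u x)) (hv₀ : ContinuousOn v₀ (cubeBd k))
    (hΦ₀ : ∀ x ∈ cubeBd k, ∀ z, u x ∈ U z → v₀ x ∈ Φ z) (he₀ : ∀ x ∈ cubeBd k, e (v₀ x) = u x)
    (hext : ∀ d ≤ k, ∀ z, LocalExt e (U z) (Φ z) d) :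
    ∃ v : (Fin k → ℝ) → T, ContinuousOn v (unitCube k) ∧ EqOn v v₀ (cubeBd k) := by
  obtain ⟨v, h1, h2, -, -, -⟩ := exists_grid_lift (v₀ := v₀) (k := k + 1)
    hU hΦ subset_rfl hu hself (isClosed_cubeBd k) hv₀ hΦ₀ he₀
    (fun _ _ _ hN h => gridCell_subset_cubeBd_or hN h)
    (fun d hd => hext d (Nat.lt_succ_iff.1 hd)) le_rfl 1 zero_lt_one
  refine ⟨v, h1.mono ?_, h2⟩
  have := gridCell_subset_gridSkel (R := unitCube k) (N := 1) (d := k + 1) (p := (0, Finset.univ))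
    ⟨gridCell_one_univ.le, by simp⟩
  rw [gridCell_one_univ] at this
  exact this.trans subset_union_right

end Lift

/-- The retraction of `Fin d → ℝ` onto the unit cube. -/
noncomputable def clampCube {d : ℕ} (x : Fin d → ℝ) : Fin d → ℝ := fun i => max 0 (min 1 (x i))

theorem continuous_clampCube {d : ℕ} : Continuous (clampCube (d := d)) := by
  unfold clampCube; fun_prop

theorem clampCube_mem {d : ℕ} (x : Fin d → ℝ) : clampCube x ∈ unitCube d :=
  mem_unitCube_iff.2 fun _ => ⟨le_max_left _ _, max_le zero_le_one (min_le_left _ _)⟩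

theorem clampCube_of_mem {d : ℕ} {x : Fin d → ℝ} (hx : x ∈ unitCube d) : clampCube x = x := by
  ext i
  have := mem_unitCube_iff.1 hx i
  simp [clampCube, this.1, this.2]

theorem prismBd_eq {d : ℕ} : prismBd d =
    unitCube d ×ˢ {0} ∪ unitCube d ×ˢ {1} ∪ cubeBd d ×ˢ Icc (0 : ℝ) 1 := by
  ext ⟨x, t⟩
  simp only [prismBd, mem_ofPred_eq, mem_union, mem_prod, mem_singleton_iff]
  constructor
  · rintro ⟨h1, h2, h | h | h⟩
    · exact Or.inl (Or.inl ⟨h1, h⟩)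
    · exact Or.inl (Or.inr ⟨h1, h⟩)
    · exact Or.inr ⟨h, h2⟩
  · rintro ((⟨h1, rfl⟩ | ⟨h1, rfl⟩) | ⟨h1, h2⟩)
    · exact ⟨h1, by simp, Or.inl rfl⟩
    · exact ⟨h1, by simp, Or.inr (Or.inl rfl)⟩
    · exact ⟨h1.1, h2, Or.inr (Or.inr h1)⟩

variable {X Y : Type*} [TopologicalSpace X] [TopologicalSpace Y]

/-- Homotopies prescribed on the boundary of a prism extend. -/
theorem CubeExt.exists_homotopy {A : Set Y} {d : ℕ} (h : CubeExt A (d + 1))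
    {g₀ g₁ : (Fin d → ℝ) → Y} {H : (Fin d → ℝ) × ℝ → Y} (h₀ : ContinuousOn g₀ (unitCube d))
    (h₁ : ContinuousOn g₁ (unitCube d)) (hH : ContinuousOn H (cubeBd d ×ˢ Icc (0 : ℝ) 1))
    (hA₀ : MapsTo g₀ (unitCube d) A) (hA₁ : MapsTo g₁ (unitCube d) A)
    (hHA : MapsTo H (cubeBd d ×ˢ Icc (0 : ℝ) 1) A)
    (e₀ : ∀ x ∈ cubeBd d, H (x, 0) = g₀ x) (e₁ : ∀ x ∈ cubeBd d, H (x, 1) = g₁ x) :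
    ∃ G : (Fin d → ℝ) × ℝ → Y, ContinuousOn G (unitCube d ×ˢ Icc (0 : ℝ) 1) ∧
      MapsTo G (unitCube d ×ˢ Icc (0 : ℝ) 1) A ∧ (∀ x ∈ unitCube d, G (x, 0) = g₀ x) ∧
      (∀ x ∈ unitCube d, G (x, 1) = g₁ x) ∧ EqOn G H (cubeBd d ×ˢ Icc (0 : ℝ) 1) := by
  classical
  let F : (Fin d → ℝ) × ℝ → Y := fun p =>
    if p.2 = 0 then g₀ p.1 else if p.2 = 1 then g₁ p.1 else H p
  have a0 : EqOn F (fun p => g₀ p.1) (unitCube d ×ˢ {0}) := by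
    rintro ⟨x, t⟩ ⟨-, ht⟩
    simp only [mem_singleton_iff] at ht
    simp [F, ht]
  have a1 : EqOn F (fun p => g₁ p.1) (unitCube d ×ˢ {1}) := by
    rintro ⟨x, t⟩ ⟨-, ht⟩
    simp only [mem_singleton_iff] at ht
    simp [F, ht]
  have a2 : EqOn F H (cubeBd d ×ˢ Icc (0 : ℝ) 1) := by
    rintro ⟨x, t⟩ ⟨hx, -⟩
    by_cases ht : t = 0
    · subst ht; simp [F, e₀ x hx]
    · by_cases ht' : t = 1
      · subst ht'; simp [F, e₁ x hx]
      · simp [F, ht, ht']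
  have hF : ContinuousOn F (prismBd d) := by
    rw [prismBd_eq]
    refine ContinuousOn.union_of_isClosed (ContinuousOn.union_of_isClosed ?_ ?_ ?_ ?_) ?_ ?_ ?_
    · exact (h₀.comp continuous_fst.continuousOn fun p hp => hp.1).congr a0
    · exact (h₁.comp continuous_fst.continuousOn fun p hp => hp.1).congr a1
    · exact isClosed_Icc.prod isClosed_singleton
    · exact isClosed_Icc.prod isClosed_singleton
    · exact hH.congr a2
    · exact (isClosed_Icc.prod isClosed_singleton).union (isClosed_Icc.prod isClosed_singleton)
    · exact (isClosed_cubeBd d).prod isClosed_Icc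
  have hFA : MapsTo F (prismBd d) A := by
    rw [prismBd_eq]
    rintro p ((hp | hp) | hp)
    · rw [a0 hp]; exact hA₀ hp.1
    · rw [a1 hp]; exact hA₁ hp.1
    · rw [a2 hp]; exact hHA hp
  obtain ⟨G, hG, hGA, hGF⟩ := h.prism F hF hFA
  refine ⟨G, hG, hGA, fun x hx => ?_, fun x hx => ?_, fun p hp => ?_⟩
  · have m : (x, (0 : ℝ)) ∈ unitCube d ×ˢ {(0 : ℝ)} := ⟨hx, rfl⟩
    rw [hGF (prismBd_eq ▸ Or.inl (Or.inl m)), a0 m]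
  · have m : (x, (1 : ℝ)) ∈ unitCube d ×ˢ {(1 : ℝ)} := ⟨hx, rfl⟩
    rw [hGF (prismBd_eq ▸ Or.inl (Or.inr m)), a1 m]
  · rw [hGF (prismBd_eq ▸ Or.inr hp), a2 hp]

theorem continuousOn_path_homotopy {d : ℕ} {v : (Fin d → ℝ) → X × C(I, Y)} {s : Set (Fin d → ℝ)}
    (hv : ContinuousOn v s) :
    ContinuousOn (fun p : (Fin d → ℝ) × ℝ => (v p.1).2 (projIcc 0 1 (zero_le_one' ℝ) p.2))
      (s ×ˢ Icc (0 : ℝ) 1) := by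
  have hev : Continuous fun p : C(I, Y) × I => p.1 p.2 := continuous_eval
  have h1 : ContinuousOn (fun p : (Fin d → ℝ) × ℝ => (v p.1).2) (s ×ˢ Icc (0 : ℝ) 1) :=
    continuous_snd.comp_continuousOn (hv.comp continuous_fst.continuousOn fun p hp => hp.1)
  have h2 : Continuous fun p : (Fin d → ℝ) × ℝ => projIcc 0 1 (zero_le_one' ℝ) p.2 :=
    continuous_projIcc.comp continuous_snd
  exact hev.comp_continuousOn (h1.prodMk h2.continuousOn)

theorem localExt_path {f : X → Y} (hf : Continuous f) {P : Set X} {U : Set Y} (hPU : MapsTo f P U)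
    {d : ℕ} (hP : CubeExt P d) (hU : CubeExt U (d + 1)) :
    LocalExt (fun p : X × C(I, Y) => p.2 1) U
      {p | p.1 ∈ P ∧ p.2 0 = f p.1 ∧ ∀ t, p.2 t ∈ U} d := by
  intro u v hu huU hv hvΦ he
  obtain ⟨g, hg, hgP, hgv⟩ := hP (fun x => (v x).1) (continuous_fst.comp_continuousOn hv)
    fun x hx => (hvΦ hx).1
  obtain ⟨G, hG, hGU, hG0, hG1, hGv⟩ := hU.exists_homotopy (g₀ := f ∘ g) (g₁ := u)
    (H := fun p => (v p.1).2 (projIcc 0 1 (zero_le_one' ℝ) p.2)) (hf.comp_continuousOn hg) hu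
    (continuousOn_path_homotopy hv)
    (hPU.comp hgP) huU (fun p hp => (hvΦ hp.1).2.2 _)
    (fun x hx => by
      simp only [projIcc_left, Function.comp_apply]
      rw [hgv hx]; exact (hvΦ hx).2.1)
    (fun x hx => by simp only [projIcc_right]; exact he x hx)
  have hc : Continuous fun p : (Fin d → ℝ) × I => G (clampCube p.1, p.2) :=
    hG.comp_continuous ((continuous_clampCube.comp continuous_fst).prodMk
      (continuous_subtype_val.comp continuous_snd)) fun p => ⟨clampCube_mem _, p.2.2⟩
  let Γ : C(Fin d → ℝ, C(I, Y)) := ContinuousMap.curry ⟨_, hc⟩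
  have hΓ : ∀ x ∈ unitCube d, ∀ t : I, Γ x t = G (x, t) := by
    intro x hx t
    simp only [Γ, ContinuousMap.curry_apply, ContinuousMap.coe_mk, clampCube_of_mem hx]
  refine ⟨fun x => (g x, Γ x), hg.prodMk Γ.continuous.continuousOn, fun x hx => ⟨hgP hx, ?_, ?_⟩,
    fun x hx => ?_, fun x hx => ?_⟩
  · simp [hΓ x hx, hG0 x hx]
  · intro t
    simp only [hΓ x hx]
    exact hGU ⟨hx, t.2⟩
  · refine Prod.ext (hgv hx) (ContinuousMap.ext fun t => ?_)
    simp only [hΓ x hx.1]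
    rw [hGv ⟨hx, t.2⟩]
    simp
  · simp [hΓ x hx, hG1 x hx]

section ExtAlong

variable {Y : Type*} [TopologicalSpace Y]

/-- The composites of `φ` with maps from the boundary of the `d`-cube to `A` extend
over the cube. -/
def ExtAlong (φ : Y → Y) (A : Set Y) (d : ℕ) : Prop :=
  ∀ g : (Fin d → ℝ) → Y, ContinuousOn g (cubeBd d) → MapsTo g (cubeBd d) A →
    ∃ g', ContinuousOn g' (unitCube d) ∧ MapsTo g' (unitCube d) A ∧ EqOn g' (φ ∘ g) (cubeBd d)

theorem extAlong_const {A : Set Y} {c : Y} (hc : c ∈ A) (d : ℕ) : ExtAlong (fun _ => c) A d :=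
  fun _ _ _ => ⟨fun _ => c, continuousOn_const, fun _ _ => hc, fun _ _ => rfl⟩

end ExtAlong

section Fibers

variable {X Y W : Type*} [TopologicalSpace X] [TopologicalSpace Y] [TopologicalSpace W]
  [Preorder Y] [Topology.IsUpperSet Y]

theorem continuousOn_upper_iff {g : W → Y} {s : Set W} :
    ContinuousOn g s ↔ ∀ x ∈ s, ∀ᶠ x' in 𝓝[s] x, g x ≤ g x' := by
  refine forall₂_congr fun x _ => ?_
  rw [ContinuousWithinAt, Topology.IsUpperSet.nhds_eq_principal_Ici, tendsto_principal]
  rfl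

theorem isOpen_Ici_upper (y : Y) : IsOpen (Ici y) :=
  Topology.IsUpperSet.isOpen_iff_isUpperSet.2 (isUpperSet_Ici y)

theorem continuousOn_jump {V : Set W} {a b : W → Y} {Z : Set W} (hZ : IsClosed Z)
    [DecidablePred (· ∈ Z)] (ha : ContinuousOn a V) (hb : ContinuousOn b V)
    (hab : ∀ x ∈ V, a x ≤ b x) : ContinuousOn (fun x => if x ∈ Z then a x else b x) V := by
  rw [continuousOn_upper_iff] at *
  intro x hx
  by_cases h : x ∈ Z
  · filter_upwards [ha x hx, self_mem_nhdsWithin] with x' h1 h2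
    simp only [h, if_true]
    split_ifs
    · exact h1
    · exact h1.trans (hab x' h2)
  · filter_upwards [hb x hx, mem_nhdsWithin_of_mem_nhds (hZ.isOpen_compl.mem_nhds h)] with x' h1 h2
    have h2' : x' ∉ Z := h2
    simpa only [h, h2', if_false] using h1

theorem MonotoneOn.comp_continuousOn_upper {A : Set Y} {Q : Type*} [TopologicalSpace Q]
    [Preorder Q] [Topology.IsUpperSet Q] {φ : Y → Q} (hφ : MonotoneOn φ A)
    {g : W → Y} {V : Set W} (hg : ContinuousOn g V) (hA : MapsTo g V A) :
    ContinuousOn (φ ∘ g) V := by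
  rw [continuousOn_upper_iff] at *
  intro x hx
  filter_upwards [hg x hx, self_mem_nhdsWithin] with x' h1 h2
  exact hφ (hA hx) (hA h2) h1

variable {A : Set Y} {φ ψ : Y → Y} {d : ℕ}

theorem ExtAlong.of_le (h : ExtAlong φ A d) (hφ : MonotoneOn φ A) (hψ : MonotoneOn ψ A)
    (hφA : MapsTo φ A A) (hψA : MapsTo ψ A A) (hle : ∀ x ∈ A, φ x ≤ ψ x) : ExtAlong ψ A d := by
  classical
  intro g hg hgA
  obtain ⟨g', h1, h2, h3⟩ := h g hg hgA
  have hm : MapsTo (Prod.fst : (Fin d → ℝ) × ℝ → _) (cubeBd d ×ˢ Icc (0 : ℝ) 1) (cubeBd d) :=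
    fun p hp => hp.1
  have hfst : ContinuousOn (Prod.fst : (Fin d → ℝ) × ℝ → _) (cubeBd d ×ˢ Icc (0 : ℝ) 1) :=
    continuous_fst.continuousOn
  obtain ⟨k, k1, k2, k3⟩ := extend_of_homotopy
    (H := fun p => if p ∈ {p : (Fin d → ℝ) × ℝ | p.2 = 0} then (φ ∘ g) p.1 else (ψ ∘ g) p.1)
    (continuousOn_jump (isClosed_eq continuous_snd continuous_const)
      ((hφ.comp_continuousOn_upper hg hgA).comp hfst hm)
      ((hψ.comp_continuousOn_upper hg hgA).comp hfst hm) fun p hp => hle _ (hgA hp.1))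
    (fun p hp => by
      simp only
      split_ifs
      · exact hφA (hgA hp.1)
      · exact hψA (hgA hp.1)) h1 h2 (fun x hx => by simp [h3 hx])
  exact ⟨k, k1, k2, fun x hx => by simp [k3 x hx]⟩

theorem ExtAlong.of_ge (h : ExtAlong ψ A d) (hφ : MonotoneOn φ A) (hψ : MonotoneOn ψ A)
    (hφA : MapsTo φ A A) (hψA : MapsTo ψ A A) (hle : ∀ x ∈ A, φ x ≤ ψ x) : ExtAlong φ A d := by
  classical
  intro g hg hgA
  obtain ⟨g', h1, h2, h3⟩ := h g hg hgA
  have hm : MapsTo (Prod.fst : (Fin d → ℝ) × ℝ → _) (cubeBd d ×ˢ Icc (0 : ℝ) 1) (cubeBd d) :=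
    fun p hp => hp.1
  have hfst : ContinuousOn (Prod.fst : (Fin d → ℝ) × ℝ → _) (cubeBd d ×ˢ Icc (0 : ℝ) 1) :=
    continuous_fst.continuousOn
  obtain ⟨k, k1, k2, k3⟩ := extend_of_homotopy
    (H := fun p => if p ∈ {p : (Fin d → ℝ) × ℝ | p.2 = 1} then (φ ∘ g) p.1 else (ψ ∘ g) p.1)
    (continuousOn_jump (isClosed_eq continuous_snd continuous_const)
      ((hφ.comp_continuousOn_upper hg hgA).comp hfst hm)
      ((hψ.comp_continuousOn_upper hg hgA).comp hfst hm) fun p hp => hle _ (hgA hp.1))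
    (fun p hp => by
      simp only
      split_ifs
      · exact hφA (hgA hp.1)
      · exact hψA (hgA hp.1)) h1 h2 (fun x hx => by simp [h3 hx])
  exact ⟨k, k1, k2, fun x hx => by simp [k3 x hx]⟩

theorem cubeExt_Ici (y : Y) (d : ℕ) : CubeExt (Ici y) d :=
  (extAlong_const (A := Ici y) (mem_Ici.2 le_rfl) d).of_le (ψ := id) monotoneOn_const monotoneOn_id
    (fun _ _ => mem_Ici.2 le_rfl) (fun _ h => h) fun _ h => h

variable {f : X → Y}

theorem CubeExt.map_of_fibers [Nonempty X] (hf : Continuous f)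
    (hfib : ∀ y d, CubeExt (f ⁻¹' Ici y) d) {k : ℕ} (h : CubeExt (univ : Set X) k) :
    CubeExt (univ : Set Y) k := by
  intro g hg _
  have : Nonempty (X × C(I, Y)) := ⟨Classical.arbitrary X, .const _ (g 0)⟩
  obtain ⟨v, hv, hve⟩ := exists_lift_cubeBd (e := fun p : X × C(I, Y) => p.2 1) (U := Ici)
    (Φ := fun z => {p | p.1 ∈ f ⁻¹' Ici z ∧ p.2 0 = f p.1 ∧ ∀ t, p.2 t ∈ Ici z})
    isOpen_Ici_upper (fun z z' t h1 h2 _ => ⟨le_trans h1 h2.1, h2.2.1, fun t => le_trans h1 (h2.2.2 t)⟩)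
    hg (fun x _ => mem_Ici.2 le_rfl)
    (fun d _ z => localExt_path hf (fun _ h => h) (hfib z d) (cubeExt_Ici z (d + 1)))
  obtain ⟨g', h1, -, h3⟩ := h (fun x => (v x).1) (continuous_fst.comp_continuousOn hv)
    (mapsTo_univ _ _)
  obtain ⟨k, k1, k2, k3⟩ := extend_of_homotopy (A := univ) (continuousOn_path_homotopy hv)
    (mapsTo_univ _ _) (hf.comp_continuousOn h1) (mapsTo_univ _ _) (fun x hx => by
      obtain ⟨z, hz⟩ := (hve x hx).2
      simp only [projIcc_left, Function.comp_apply]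
      rw [h3 hx]; exact hz.2.1)
  refine ⟨k, k1, k2, fun x hx => ?_⟩
  rw [k3 x hx]
  simp only [projIcc_right]
  exact (hve x hx).1

theorem CubeExt.comap_of_fibers (hf : Continuous f)
    (hfib : ∀ y d, CubeExt (f ⁻¹' Ici y) d) {k : ℕ} (h : CubeExt (univ : Set Y) k) :
    CubeExt (univ : Set X) k := by
  intro g hg _
  obtain ⟨u, hu, -, hug⟩ := h (f ∘ g) (hf.comp_continuousOn hg) (mapsTo_univ _ _)
  have hconst : Continuous fun x : X => (x, ContinuousMap.const I (f x)) :=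
    continuous_id.prodMk (ContinuousMap.continuous_const'.comp hf)
  obtain ⟨v, hv, hvg⟩ := exists_lift_unitCube (e := fun p : X × C(I, Y) => p.2 1) (U := Ici)
    (Φ := fun z => {p | p.1 ∈ f ⁻¹' Ici z ∧ p.2 0 = f p.1 ∧ ∀ t, p.2 t ∈ Ici z})
    (v₀ := fun x => (g x, ContinuousMap.const I (f (g x))))
    isOpen_Ici_upper (fun z z' t h1 h2 _ => ⟨le_trans h1 h2.1, h2.2.1, fun t => le_trans h1 (h2.2.2 t)⟩)
    hu (fun x _ => mem_Ici.2 le_rfl) (hconst.comp_continuousOn hg)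
    (fun x hx z hz => by rw [hug hx] at hz; exact ⟨hz, rfl, fun _ => hz⟩)
    (fun x hx => (hug hx).symm)
    (fun d _ z => localExt_path hf (fun _ h => h) (hfib z d) (cubeExt_Ici z (d + 1)))
  exact ⟨fun x => (v x).1, continuous_fst.comp_continuousOn hv, mapsTo_univ _ _,
    fun x hx => by simp only [hvg hx]⟩

/-- A subset that is order isomorphic to a poset inherits its extension property. -/
theorem CubeExt.range_orderEmbedding {Q : Type*} [TopologicalSpace Q] [Preorder Q]
    [Topology.IsUpperSet Q] [Nonempty Q] {d : ℕ} (h : CubeExt (univ : Set Q) d) (e : Q → Y)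
    (he : ∀ a b, e a ≤ e b ↔ a ≤ b) : CubeExt (range e) d := by
  classical
  intro g hg hgr
  choose! l hl using fun x hx => hgr (x := x) hx
  obtain ⟨g', h1, -, h3⟩ := h l (by
    rw [continuousOn_upper_iff] at *
    intro x hx
    filter_upwards [hg x hx, self_mem_nhdsWithin] with x' a1 a2
    rwa [← he, hl x hx, hl x' a2]) (mapsTo_univ _ _)
  refine ⟨e ∘ g', ?_, fun x _ => mem_range_self _, fun x hx => ?_⟩
  · exact MonotoneOn.comp_continuousOn_upper (A := univ) (fun a _ b _ hab => (he a b).2 hab) h1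
      (mapsTo_univ _ _)
  · simp [h3 hx, hl x hx]

end Fibers

section Glue

variable {X : Type*} [TopologicalSpace X]

theorem CubeExt.union_iUnion {ι : Type*} {A : Set X} {B : ι → Set X} (hAo : IsOpen A)
    (hBo : ∀ j, IsOpen (B j)) (hAB : ∀ i j, i ≠ j → B i ∩ B j ⊆ A) {k : ℕ} (hA : CubeExt A k)
    (hB : ∀ j, ∀ d ≤ k, CubeExt (B j) d) (hI : ∀ j, ∀ d < k, CubeExt (A ∩ B j) d) :
    CubeExt (A ∪ ⋃ j, B j) k := by
  classical
  intro g hg hgW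
  have : Nonempty (X × C(I, X)) := ⟨g 0, .const _ (g 0)⟩
  let U : X → Set X := fun z => if z ∈ A then A else if h : ∃ j, z ∈ B j then B h.choose else ∅
  let Φ : X → Set (X × C(I, X)) := fun z =>
    if z ∈ A then {p | p.1 ∈ A ∧ p.2 = .const _ p.1}
    else {p | p.1 ∈ A ∩ U z ∧ p.2 0 = id p.1 ∧ ∀ t, p.2 t ∈ U z}
  have hU1 : ∀ z ∈ A, U z = A := fun z hz => by simp [U, hz]
  have hU2 : ∀ z, z ∉ A → ∀ j, z ∈ B j → U z = B j := by
    intro z hz j hj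
    have h : ∃ j, z ∈ B j := ⟨j, hj⟩
    simp only [U, hz, if_false, dif_pos h]
    by_contra hne
    exact hz (hAB h.choose j (fun e => hne (by rw [e])) ⟨h.choose_spec, hj⟩)
  have hU3 : ∀ z, z ∉ A → (¬ ∃ j, z ∈ B j) → U z = ∅ := by
    intro z hz h; simp [U, hz, not_exists.1 h]
  have hUW : ∀ z, U z ⊆ A ∪ ⋃ j, B j := by
    intro z
    by_cases hz : z ∈ A
    · rw [hU1 z hz]; exact subset_union_left
    · by_cases h : ∃ j, z ∈ B j
      · obtain ⟨j, hj⟩ := h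
        rw [hU2 z hz j hj]
        exact (subset_iUnion B j).trans subset_union_right
      · rw [hU3 z hz h]; exact empty_subset _
  have hUo : ∀ z, IsOpen (U z) := by
    intro z
    by_cases hz : z ∈ A
    · rw [hU1 z hz]; exact hAo
    · by_cases h : ∃ j, z ∈ B j
      · obtain ⟨j, hj⟩ := h
        rw [hU2 z hz j hj]; exact hBo j
      · rw [hU3 z hz h]; exact isOpen_empty
  have hΦ : ∀ z z' p, z' ∈ U z → p ∈ Φ z' → p.2 1 ∈ U z → p ∈ Φ z := by
    intro z z' p hz' hp he
    by_cases hz : z ∈ A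
    · rw [hU1 z hz] at hz'
      simpa only [Φ, hz, hz', if_true] using hp
    · by_cases h : ∃ j, z ∈ B j
      · obtain ⟨j, hj⟩ := h
        have hUz := hU2 z hz j hj
        by_cases hA' : z' ∈ A
        · simp only [Φ, hA', if_true] at hp
          simp only [Φ, hz, if_false]
          rw [hp.2] at he
          simp only [ContinuousMap.const_apply] at he
          exact ⟨⟨hp.1, he⟩, by rw [hp.2]; rfl, fun t => by rw [hp.2]; exact he⟩
        · have hUz' := hU2 z' hA' j (hUz ▸ hz')
          simp only [Φ, hA', hz, if_false, hUz, hUz'] at hp ⊢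
          exact hp
      · rw [hU3 z hz h] at hz'; exact hz'.elim
  have hself : ∀ x ∈ cubeBd k, g x ∈ U (g x) := by
    intro x hx
    by_cases hz : g x ∈ A
    · rw [hU1 _ hz]; exact hz
    · have := (hgW hx).resolve_left hz
      obtain ⟨j, hj⟩ := mem_iUnion.1 this
      rw [hU2 _ hz j hj]; exact hj
  have hext : ∀ d < k, ∀ z,
      LocalExt (fun p : X × C(I, X) => p.2 1) (U z) (Φ z) d := by
    intro d hd z
    by_cases hz : z ∈ A
    · simp only [Φ, hz, if_true, hU1 z hz]
      intro u v hu huA hv hvΦ he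
      refine ⟨fun x => (u x, .const _ (u x)),
        hu.prodMk (ContinuousMap.continuous_const'.comp_continuousOn hu),
        fun x hx => ⟨huA hx, rfl⟩, fun x hx => ?_, fun x _ => rfl⟩
      have h1 := (hvΦ hx).2
      have h2 : (v x).2 1 = u x := he x hx
      rw [h1] at h2
      simp only [ContinuousMap.const_apply] at h2
      exact Prod.ext h2.symm (by simp only [h1, h2])
    · simp only [Φ, hz, if_false]
      by_cases h : ∃ j, z ∈ B j
      · obtain ⟨j, hj⟩ := h
        rw [hU2 z hz j hj]
        exact localExt_path continuous_id (fun _ h => h.2) (hI j d hd) (hB j (d + 1) hd)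
      · rw [hU3 z hz h]
        intro u v _ hu
        exact (hu (clampCube_mem 0)).elim
  obtain ⟨v, hv, hve⟩ := exists_lift_cubeBd (e := fun p : X × C(I, X) => p.2 1) (U := U) (Φ := Φ)
    (u := g) (k := k) hUo hΦ hg hself hext
  have hvA : ∀ x ∈ cubeBd k, (v x).1 ∈ A ∧ (v x).2 0 = (v x).1 ∧
      ∀ t, (v x).2 t ∈ A ∪ ⋃ j, B j := by
    intro x hx
    obtain ⟨z, hz⟩ := (hve x hx).2
    by_cases hzA : z ∈ A
    · simp only [Φ, hzA, if_true] at hz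
      refine ⟨hz.1, by rw [hz.2]; rfl, fun t => Or.inl ?_⟩
      rw [hz.2]; exact hz.1
    · simp only [Φ, hzA, if_false] at hz
      exact ⟨hz.1.1, hz.2.1, fun t => hUW z (hz.2.2 t)⟩
  obtain ⟨g', h1, h2, h3⟩ := hA (fun x => (v x).1) (continuous_fst.comp_continuousOn hv)
    fun x hx => (hvA x hx).1
  obtain ⟨w, k1, k2, k3⟩ := extend_of_homotopy (A := A ∪ ⋃ j, B j) (continuousOn_path_homotopy hv)
    (fun p hp => (hvA p.1 hp.1).2.2 _) h1 (fun x hx => Or.inl (h2 hx)) (fun x hx => by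
      simp only [projIcc_left]
      rw [h3 hx]; exact (hvA x hx).2.1)
  refine ⟨w, k1, k2, fun x hx => ?_⟩
  rw [k3 x hx]
  simp only [projIcc_right]
  exact (hve x hx).1

theorem CubeExt.iUnion_nat {A : ℕ → Set X} (hA : ∀ n, IsOpen (A n)) (hm : Monotone A) {d : ℕ}
    (h : ∀ n, CubeExt (A n) d) : CubeExt (⋃ n, A n) d := by
  intro g hg hgA
  obtain ⟨n, hn⟩ := ((isCompact_cubeBd d).image_of_continuousOn hg).elim_directed_cover A hA
    (image_subset_iff.2 hgA) hm.directed_le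
  obtain ⟨g', h1, h2, h3⟩ := h n g hg (image_subset_iff.1 hn)
  exact ⟨g', h1, h2.mono_right (subset_iUnion A n), h3⟩

end Glue

section HomotopyGroup

variable {X : Type*} [TopologicalSpace X]

theorem exists_nullhomotopy {i : ℕ} (h : ∀ x : X, Subsingleton (HomotopyGroup (Fin i) X x)) (c : X)
    {a : (Fin i → ℝ) → X} (ha : ContinuousOn a (unitCube i)) (hc : ∀ x ∈ cubeBd i, a x = c) :
    ∃ K : (Fin i → ℝ) × ℝ → X, ContinuousOn K (unitCube i ×ˢ Icc (0 : ℝ) 1) ∧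
      (∀ x ∈ unitCube i, K (x, 0) = a x) ∧ (∀ x ∈ unitCube i, K (x, 1) = c) ∧
      ∀ p ∈ cubeBd i ×ˢ Icc (0 : ℝ) 1, K p = c := by
  have hm : ∀ y : Fin i → I, (fun j => (y j : ℝ)) ∈ unitCube i := fun y =>
    mem_unitCube_iff.2 fun j => ⟨(y j).2.1, (y j).2.2⟩
  let p : GenLoop (Fin i) X c := ⟨⟨fun y => a fun j => (y j : ℝ),
    ha.comp_continuous (by fun_prop) hm⟩, fun y ⟨j, hj⟩ => hc _ ⟨hm y, j, by
      rcases hj with hj | hj <;> simp [hj]⟩⟩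
  have hpc : GenLoop.Homotopic p GenLoop.const :=
    Quotient.exact ((h c).elim (Quotient.mk _ p : HomotopyGroup (Fin i) X c)
      (Quotient.mk _ GenLoop.const))
  obtain ⟨F⟩ := hpc
  let q : (Fin i → ℝ) → Fin i → I := fun x j => projIcc 0 1 zero_le_one (x j)
  have hq : Continuous q := continuous_pi fun j => continuous_projIcc.comp (continuous_apply j)
  have hqm : ∀ x ∈ unitCube i, ∀ j, (q x j : ℝ) = x j := fun x hx j => by
    have := mem_unitCube_iff.1 hx j
    simp [q, projIcc_of_mem _ (show x j ∈ Icc (0 : ℝ) 1 from this)]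
  refine ⟨fun z => F (projIcc 0 1 zero_le_one z.2, q z.1), ?_, fun x hx => ?_, fun x hx => ?_, ?_⟩
  · exact (F.continuous.comp ((continuous_projIcc.comp continuous_snd).prodMk
      (hq.comp continuous_fst))).continuousOn
  · simp only [projIcc_left]
    refine (F.apply_zero _).trans ?_
    change a (fun j => (q x j : ℝ)) = a x
    congr 1; exact funext (hqm x hx)
  · simp only [projIcc_right]
    exact F.apply_one _
  · rintro ⟨x, t⟩ ⟨⟨hx, j, (hj : x j = 0 ∨ x j = 1)⟩, -⟩
    have hb : q x ∈ Cube.boundary (Fin i) := ⟨j, by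
      rcases hj with hj | hj <;> simp [q, hj]⟩
    exact (F.eq_fst _ hb).trans (p.2 _ hb)

theorem cubeExt_univ_of_subsingleton {i : ℕ}
    (h : ∀ x : X, Subsingleton (HomotopyGroup (Fin i) X x)) :
    CubeExt (univ : Set X) (i + 1) := by
  classical
  intro g hg _
  have hcons : ∀ x : Fin (i + 1) → ℝ, x = Fin.cons (x 0) (Fin.tail x) := fun x =>
    (Fin.cons_self_tail x).symm
  have htail : Continuous fun x : Fin (i + 1) → ℝ => (Fin.tail x : Fin i → ℝ) := by
    unfold Fin.tail; fun_prop
  have hbox : MapsTo (fun p : (Fin i → ℝ) × ℝ => (Fin.cons p.2 p.1 : Fin (i + 1) → ℝ)) (openBox i)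
      (cubeBd (i + 1)) := by
    rintro ⟨x, t⟩ ⟨h1, h2, h3⟩
    exact cons_mem_cubeBd.2 ⟨h1, h2, by tauto⟩
  obtain ⟨G, hG, hGg, -⟩ := homotopy_extension _
    (hg.comp continuous_cons.continuousOn hbox)
  have hshrink : MapsTo (fun p : ((Fin i → ℝ) × ℝ) × ℝ => (1 - p.2) • p.1)
      ((unitCube i ×ˢ Icc (0 : ℝ) 1) ×ˢ Icc (0 : ℝ) 1) (unitCube i ×ˢ Icc (0 : ℝ) 1) := by
    rintro ⟨⟨x, t⟩, s⟩ ⟨⟨hx, ht0, ht1⟩, hs0, hs1⟩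
    simp only at ht0 ht1 hs0 hs1
    refine ⟨mem_unitCube_iff.2 fun j => ?_, ?_, ?_⟩
    · have := mem_unitCube_iff.1 hx j
      simp only [Prod.smul_mk, Pi.smul_apply, smul_eq_mul]
      constructor <;> nlinarith
    · simp only [Prod.smul_mk, smul_eq_mul]; nlinarith
    · simp only [Prod.smul_mk, smul_eq_mul]; nlinarith
  have hGs := hG.comp (f := fun p : ((Fin i → ℝ) × ℝ) × ℝ => (1 - p.2) • p.1)
    (by fun_prop) hshrink
  have htop : MapsTo (fun x : Fin i → ℝ => (Fin.cons 1 x : Fin (i + 1) → ℝ)) (unitCube i)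
      (cubeBd (i + 1)) := fun x hx => cons_mem_cubeBd.2 ⟨hx, by simp, by simp⟩
  obtain ⟨A, hA, -, hA0, hA1⟩ := extend_homotopy (A := univ)
    (H := fun p : (Fin i → ℝ) × ℝ => G ((1 - p.2) • (p.1, 1))) (g := fun x => g (Fin.cons 1 x))
    (hGs.comp (f := fun p : (Fin i → ℝ) × ℝ => ((p.1, (1 : ℝ)), p.2)) (by fun_prop)
      fun p hp => ⟨⟨hp.1.1, by simp⟩, hp.2⟩) (mapsTo_univ _ _)
    (hg.comp (continuous_cons.comp (by fun_prop : Continuous fun x : Fin i → ℝ => (x, (1 : ℝ)))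
      |>.continuousOn) htop) (mapsTo_univ _ _)
    (fun x hx => by
      simp only [sub_zero, one_smul]
      exact hGg ⟨hx.1, by simp, Or.inr hx⟩)
  obtain ⟨K, hK, hK0, hK1, hKc⟩ := exists_nullhomotopy h (G 0) (a := fun x => A (x, 1))
    (hA.comp (by fun_prop) fun x hx => ⟨hx, by simp⟩)
    (fun x hx => by rw [hA1 ⟨hx, by simp⟩]; simp)
  have hsplit : Continuous fun x : Fin (i + 1) → ℝ => ((Fin.tail x : Fin i → ℝ), x 0) :=
    htail.prodMk (continuous_apply 0)
  have hmem : ∀ x ∈ cubeBd (i + 1), (Fin.tail x, x 0) ∈ unitCube i ×ˢ Icc (0 : ℝ) 1 :=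
    fun x hx => cons_mem_unitCube.1 (hcons x ▸ hx.1)
  have hcover : ∀ x ∈ cubeBd (i + 1), x 0 = 1 ∨ (Fin.tail x, x 0) ∈ openBox i := by
    intro x hx
    rw [hcons x] at hx
    obtain ⟨h1, h2, h3 | h3 | h3⟩ := cons_mem_cubeBd.1 hx
    · exact Or.inr ⟨h1, h2, Or.inl h3⟩
    · exact Or.inl h3
    · exact Or.inr ⟨h1, h2, Or.inr h3⟩
  have hclosed : IsClosed (openBox i) := by
    rw [openBox_eq]
    exact (isClosed_Icc.prod isClosed_singleton).union ((isClosed_cubeBd i).prod isClosed_Icc)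
  let H : (Fin (i + 1) → ℝ) × ℝ → X := fun p =>
    if p.1 0 = 1 then A (Fin.tail p.1, 1 - p.2) else G (p.2 • (Fin.tail p.1, p.1 0))
  have hH : ContinuousOn H (cubeBd (i + 1) ×ˢ Icc (0 : ℝ) 1) := by
    let S : Set ((Fin (i + 1) → ℝ) × ℝ) := (cubeBd (i + 1) ∩ {x | x 0 = 1}) ×ˢ Icc (0 : ℝ) 1
    let S' : Set ((Fin (i + 1) → ℝ) × ℝ) :=
      (cubeBd (i + 1) ∩ {x | (Fin.tail x, x 0) ∈ openBox i}) ×ˢ Icc (0 : ℝ) 1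
    have hSS : cubeBd (i + 1) ×ˢ Icc (0 : ℝ) 1 = S ∪ S' := by
      ext ⟨x, t⟩
      simp only [S, S', mem_prod, mem_union, mem_inter_iff, mem_ofPred_eq]
      have := hcover x
      tauto
    rw [hSS]
    refine ContinuousOn.union_of_isClosed ?_ ?_ ?_ ?_
    · have : EqOn H (fun p => A (Fin.tail p.1, 1 - p.2)) S := by
        rintro ⟨x, t⟩ ⟨⟨-, hx : x 0 = 1⟩, -⟩
        simp [H, hx]
      refine ContinuousOn.congr ?_ this
      refine hA.comp ((htail.comp continuous_fst).prodMk (by fun_prop)).continuousOn ?_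
      rintro ⟨x, t⟩ ⟨⟨hx, -⟩, ht0, ht1⟩
      simp only at ht0 ht1
      exact ⟨(hmem x hx).1, by simp only [mem_Icc]; constructor <;> linarith⟩
    · have : EqOn H (fun p => G (p.2 • (Fin.tail p.1, p.1 0))) S' := by
        rintro ⟨x, t⟩ ⟨⟨-, hx⟩, ht0, ht1⟩
        simp only at ht0 ht1
        by_cases h1 : x 0 = 1
        · obtain ⟨-, -, h3⟩ := hx
          have h3 : Fin.tail x ∈ cubeBd i := h3.resolve_left (by simp [h1])
          simp only [H, h1, if_true]
          rw [hA1 ⟨h3, by simp only [mem_Icc]; constructor <;> linarith⟩]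
          simp
        · simp [H, h1]
      refine ContinuousOn.congr ?_ this
      refine (hGs.comp (f := fun p : (Fin (i + 1) → ℝ) × ℝ => ((Fin.tail p.1, p.1 0), 1 - p.2))
        ((hsplit.comp continuous_fst).prodMk (by fun_prop)).continuousOn ?_).congr ?_
      · rintro ⟨x, t⟩ ⟨⟨hx, -⟩, ht0, ht1⟩
        simp only at ht0 ht1
        exact ⟨hmem x hx, by simp only [mem_Icc]; constructor <;> linarith⟩
      · rintro ⟨x, t⟩ -
        simp
    · exact ((isClosed_cubeBd _).inter (isClosed_eq (continuous_apply 0) continuous_const)).prod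
        isClosed_Icc
    · exact ((isClosed_cubeBd _).inter (hclosed.preimage hsplit)).prod isClosed_Icc
  obtain ⟨g', h1, h2, h3⟩ := extend_of_homotopy (A := univ) hH (mapsTo_univ _ _)
    (g := fun x => K (Fin.tail x, 1 - x 0))
    (hK.comp (htail.prodMk (by fun_prop)).continuousOn (fun x hx => by
      obtain ⟨h1, h2, h3⟩ := cons_mem_unitCube.1 (hcons x ▸ hx)
      exact ⟨h1, by simp only [mem_Icc]; constructor <;> linarith⟩)) (mapsTo_univ _ _)
    (fun x hx => by
      by_cases h1 : x 0 = 1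
      · simp [H, h1, hK0 _ (hmem x hx).1]
      · obtain ⟨a1, ⟨a2, a3⟩, a4⟩ := (hcover x hx).resolve_left h1
        simp only [H, h1, if_false, zero_smul]
        rcases a4 with a4 | a4
        · simp only at a4
          simp [a4, hK1 _ a1]
        · simp only at a2 a3
          exact (hKc (Fin.tail x, 1 - x 0)
            ⟨a4, by simp only [mem_Icc]; constructor <;> linarith⟩).symm)
  refine ⟨g', h1, h2, fun x hx => ?_⟩
  rw [h3 x hx]
  by_cases h1 : x 0 = 1
  · simp only [H, h1, if_true, sub_self]
    rw [hA0 _ (hmem x hx).1]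
    conv_rhs => rw [hcons x, h1]
  · simp only [H, h1, if_false, one_smul]
    rw [hGg ((hcover x hx).resolve_left h1)]
    exact congrArg g (hcons x).symm

theorem CubeExt.subsingleton_homotopyGroup {i : ℕ} (h : CubeExt (univ : Set X) (i + 1)) (x : X) :
    Subsingleton (HomotopyGroup (Fin i) X x) := by
  refine ⟨fun a b => Quotient.inductionOn₂ a b fun p q => Quotient.sound ?_⟩
  let r : (Fin i → ℝ) → Fin i → I := fun x j => projIcc 0 1 zero_le_one (x j)
  have hr : Continuous r := continuous_pi fun j => continuous_projIcc.comp (continuous_apply j)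
  have hrb : ∀ x ∈ cubeBd i, r x ∈ Cube.boundary (Fin i) := by
    rintro y ⟨-, j, hj⟩
    exact ⟨j, by rcases hj with hj | hj <;> simp [r, hj]⟩
  obtain ⟨G, hG, -, hG0, hG1, hGH⟩ := h.exists_homotopy (g₀ := p ∘ r) (g₁ := q ∘ r)
    (H := fun _ => x) (p.1.continuous.comp hr).continuousOn (q.1.continuous.comp hr).continuousOn
    continuousOn_const (mapsTo_univ _ _) (mapsTo_univ _ _) (mapsTo_univ _ _)
    (fun y hy => (p.2 _ (hrb y hy)).symm) (fun y hy => (q.2 _ (hrb y hy)).symm)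
  have hm : ∀ y : Fin i → I, (fun j => (y j : ℝ)) ∈ unitCube i := fun y =>
    mem_unitCube_iff.2 fun j => ⟨(y j).2.1, (y j).2.2⟩
  have hrm : ∀ y : Fin i → I, r (fun j => (y j : ℝ)) = y := fun y => by ext j; simp [r]
  refine ⟨⟨⟨⟨fun z => G (fun j => (z.2 j : ℝ), z.1), ?_⟩, fun y => ?_, fun y => ?_⟩, ?_⟩⟩
  · exact hG.comp_continuous (by fun_prop) fun z => ⟨hm z.2, z.1.2⟩
  · simp [hG0 _ (hm y), hrm]
  · simp [hG1 _ (hm y), hrm]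
  · intro t y hy
    obtain ⟨j, hj⟩ := hy
    have hb : (fun j => (y j : ℝ)) ∈ cubeBd i := ⟨hm y, j, by
      rcases hj with hj | hj <;> simp [hj]⟩
    exact (hGH (x := (fun j => (y j : ℝ), (t : ℝ))) ⟨hb, t.2⟩).trans (p.2 _ ⟨j, hj⟩).symm

theorem cubeExt_univ_zero : CubeExt (univ : Set X) 0 := fun g _ _ =>
  ⟨g, continuous_of_discreteTopology.continuousOn, mapsTo_univ _ _, fun _ _ => rfl⟩

end HomotopyGroup

theorem isConn_iff_cubeExt {X : Type} [TopologicalSpace X] {n : ℤ} :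
    IsConn X n ↔ (-1 ≤ n → Nonempty X) ∧
      ∀ d : ℕ, (d : ℤ) ≤ n + 1 → CubeExt (univ : Set X) d := by
  refine and_congr_right fun _ => ⟨fun h d hd => ?_, fun h i hi => ?_⟩
  · cases d with
    | zero => exact cubeExt_univ_zero
    | succ i => exact cubeExt_univ_of_subsingleton (h i (by push_cast at hd; omega))
  · exact (h (i + 1) (by push_cast; omega)).subsingleton_homotopyGroup

section OrderDual

variable {P Q : Type*}

/-- Extendability of maps into a poset with its upper set topology. -/
def PosetExt (P : Type*) [Preorder P] (d : ℕ) : Prop :=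
  CubeExt (univ : Set (Topology.WithUpperSet P)) d

theorem cubeExt_upper_of_zigzag [Preorder P] [TopologicalSpace P] [Topology.IsUpperSet P]
    {A : Set P} {c : P} (hc : c ∈ A) (φ : P → P) (hφA : MapsTo φ A A) (hφ : MonotoneOn φ A)
    (h1 : ∀ x ∈ A, φ x ≤ x) (h2 : ∀ x ∈ A, φ x ≤ c) (d : ℕ) : CubeExt A d :=
  ((extAlong_const hc d).of_ge hφ monotoneOn_const hφA (fun _ _ => hc) h2).of_le (ψ := id) hφ
    monotoneOn_id hφA (fun _ h => h) h1

variable [Preorder P] [Preorder Q]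

theorem PosetExt.of_retract {d : ℕ} (h : PosetExt P d) (r : P →o Q) (i : Q →o P)
    (hri : ∀ q, r (i q) = q) : PosetExt Q d := by
  intro g hg _
  obtain ⟨g', h1, -, h3⟩ := h (Topology.WithUpperSet.map i ∘ g)
    ((Topology.WithUpperSet.map i).continuous.comp_continuousOn hg) (mapsTo_univ _ _)
  refine ⟨Topology.WithUpperSet.map r ∘ g',
    (Topology.WithUpperSet.map r).continuous.comp_continuousOn h1, mapsTo_univ _ _, fun x hx => ?_⟩
  simp only [Function.comp_apply, h3 hx]
  exact hri _

theorem PosetExt.orderDual [Nonempty P] {d : ℕ} (h : PosetExt P d) : PosetExt Pᵒᵈ d := by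
  classical
  let Tw := {p : P × Pᵒᵈ // p.1 ≤ OrderDual.ofDual p.2}
  let f₁ : Tw →o P := ⟨fun p => p.1.1, fun _ _ h => h.1⟩
  let f₂ : Tw →o Pᵒᵈ := ⟨fun p => p.1.2, fun _ _ h => h.2⟩
  have : Nonempty (Topology.WithUpperSet Tw) :=
    ⟨⟨(Classical.arbitrary P, OrderDual.toDual (Classical.arbitrary P)), le_rfl⟩⟩
  have hT : PosetExt Tw d := by
    refine CubeExt.comap_of_fibers (Topology.WithUpperSet.map f₁).continuous (fun (r : P) => ?_) h
    let φ : Tw → Tw := fun p => if hp : r ≤ p.1.1 then ⟨(r, p.1.2), le_trans hp p.2⟩ else p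
    have hφ : ∀ p : Tw, r ≤ p.1.1 → (φ p).1 = (r, p.1.2) := fun p hp => by simp [φ, hp]
    refine cubeExt_upper_of_zigzag (P := Topology.WithUpperSet Tw)
      (c := ⟨(r, OrderDual.toDual r), le_rfl⟩) (le_refl r) φ ?_ ?_ ?_ ?_
    · intro p hp
      have h1 := hφ p hp
      change r ≤ (φ p).1.1
      rw [h1]
    · intro p hp q hq hpq
      change (φ p).1 ≤ (φ q).1
      rw [hφ p hp, hφ q hq]
      exact ⟨le_rfl, hpq.2⟩
    · intro p hp
      change (φ p).1 ≤ p.1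
      rw [hφ p hp]
      exact ⟨hp, le_rfl⟩
    · intro p hp
      change (φ p).1 ≤ (r, OrderDual.toDual r)
      rw [hφ p hp]
      exact ⟨le_rfl, (le_trans hp p.2 : r ≤ OrderDual.ofDual p.1.2)⟩
  refine CubeExt.map_of_fibers (Topology.WithUpperSet.map f₂).continuous (fun (r : Pᵒᵈ) => ?_) hT
  let φ : Tw → Tw := fun p => if hp : r ≤ p.1.2 then ⟨(p.1.1, r), le_trans p.2 hp⟩ else p
  have hφ : ∀ p : Tw, r ≤ p.1.2 → (φ p).1 = (p.1.1, r) := fun p hp => by simp [φ, hp]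
  refine cubeExt_upper_of_zigzag (P := Topology.WithUpperSet Tw)
    (c := ⟨(OrderDual.ofDual r, r), le_rfl⟩) (le_refl r) φ ?_ ?_ ?_ ?_
  · intro p hp
    have h1 := hφ p hp
    change r ≤ (φ p).1.2
    rw [h1]
  · intro p hp q hq hpq
    change (φ p).1 ≤ (φ q).1
    rw [hφ p hp, hφ q hq]
    exact ⟨hpq.1, le_rfl⟩
  · intro p hp
    change (φ p).1 ≤ p.1
    rw [hφ p hp]
    exact ⟨le_rfl, hp⟩
  · intro p hp
    change (φ p).1 ≤ (OrderDual.ofDual r, r)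
    rw [hφ p hp]
    exact ⟨le_trans p.2 hp, le_rfl⟩

end OrderDual

end

section

open Set Topology Filter

namespace ASC

variable {V : Type} [DecidableEq V] (L : ASC V)

/-- The poset of simplices. -/
abbrev Face : Type := {τ : Finset V // τ ∈ L.faces}

variable {L}

theorem exists_support (x : L.space) : ∃ τ : L.Face, ∀ v, v ∈ τ.1 ↔ x.1 v ≠ 0 := by
  obtain ⟨x, -, s, hs, h0, h1⟩ := x
  have hmem : ∀ v, v ∈ s.filter (fun v => x v ≠ 0) ↔ x v ≠ 0 := fun v => by
    simp only [Finset.mem_filter, and_iff_right_iff_imp]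
    intro h
    by_contra hv
    exact h (h0 v hv)
  refine ⟨⟨s.filter fun v => x v ≠ 0, L.down_closed hs (Finset.filter_subset _ _) ?_⟩, hmem⟩
  obtain ⟨v, -, hv⟩ := Finset.exists_ne_zero_of_sum_ne_zero (h1.trans_ne one_ne_zero)
  exact ⟨v, (hmem v).2 hv⟩

/-- The open simplex containing a point. -/
noncomputable def support (x : L.space) : L.Face := (exists_support x).choose

theorem mem_support {x : L.space} {v : V} : v ∈ (support x).1 ↔ x.1 v ≠ 0 :=
  (exists_support x).choose_spec v

theorem sum_support (x : L.space) {t : Finset V} (ht : (support x).1 ⊆ t) :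
    ∑ v ∈ t, x.1 v = 1 := by
  obtain ⟨s, hs, h0, h1⟩ := x.2.2
  rw [← h1, ← Finset.sum_subset ht fun v _ hv => by simpa [mem_support] using hv]
  refine Finset.sum_subset (fun v hv => ?_) fun v _ hv => by simpa [mem_support] using hv
  by_contra h
  exact mem_support.1 hv (h0 v h)

theorem continuous_support :
    Continuous (Topology.WithUpperSet.toUpperSet ∘ support (L := L)) := by
  rw [← continuousOn_univ, continuousOn_upper_iff]
  intro x _
  rw [nhdsWithin_univ]
  have : ∀ᶠ y : L.space in 𝓝 x, ∀ v ∈ (support x).1, y.1 v ≠ 0 :=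
    (Filter.eventually_all_finset _).2 fun v hv =>
      ((continuous_apply v).comp continuous_subtype_val).continuousAt.eventually_ne
        (mem_support.1 hv)
  filter_upwards [this] with y hy v hv
  exact mem_support.2 (hy v hv)

/-- The barycenter of a simplex. -/
noncomputable def barycenter (σ : Finset V) (v : V) : ℝ := if v ∈ σ then (σ.card : ℝ)⁻¹ else 0

theorem sum_barycenter {σ t : Finset V} (hσ : σ.Nonempty) (ht : σ ⊆ t) :
    ∑ v ∈ t, barycenter σ v = 1 := by
  have hc : (σ.card : ℝ) ≠ 0 := by simpa using hσ.ne_empty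
  simp [barycenter, Finset.sum_ite_mem, Finset.inter_eq_right.2 ht, hc]

theorem barycenter_nonneg (σ : Finset V) (v : V) : 0 ≤ barycenter σ v := by
  unfold barycenter; split_ifs <;> positivity

theorem barycenter_mem_space {σ : Finset V} (hσ : σ ∈ L.faces) : barycenter σ ∈ L.space :=
  ⟨barycenter_nonneg σ, σ, hσ, fun v hv => by simp [barycenter, hv],
    sum_barycenter (L.nonempty_of_mem hσ) subset_rfl⟩

theorem cubeExt_support_preimage (σ : Topology.WithUpperSet L.Face) (d : ℕ) :
    CubeExt (Topology.WithUpperSet.toUpperSet ∘ support (L := L) ⁻¹' Ici σ) d := by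
  classical
  let γ : L.space × ℝ → V → ℝ := fun p v => (1 - p.2) * p.1.1 v + p.2 * barycenter σ.1 v
  let A := Topology.WithUpperSet.toUpperSet ∘ support (L := L) ⁻¹' Ici σ
  have hA : ∀ x ∈ A, σ.1 ⊆ (support x).1 := fun x hx => hx
  have hc : ∀ v ∈ σ.1, 0 < barycenter σ.1 v := fun v hv => by
    have : 0 < σ.1.card := Finset.card_pos.2 ⟨v, hv⟩
    simp only [barycenter, hv, if_true]
    positivity
  have hγ : ∀ p ∈ A ×ˢ Icc (0 : ℝ) 1, γ p ∈ L.space := by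
    rintro ⟨x, t⟩ ⟨hx, ht0, ht1⟩
    simp only at ht0 ht1
    refine ⟨fun v => add_nonneg (mul_nonneg (by simpa using ht1) (x.2.1 v))
      (mul_nonneg ht0 (barycenter_nonneg _ v)), (support x).1, (support x).2, fun v hv => ?_, ?_⟩
    · have h1 : x.1 v = 0 := by simpa [mem_support] using hv
      have h2 : v ∉ σ.1 := fun h => hv (hA x hx h)
      simp [γ, h1, barycenter, h2]
    · simp only [γ, Finset.sum_add_distrib, ← Finset.mul_sum]
      rw [sum_support x subset_rfl, sum_barycenter (L.nonempty_of_mem σ.2) (hA x hx)]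
      ring
  let H : L.space × ℝ → L.space := fun p => if hp : γ p ∈ L.space then ⟨γ p, hp⟩ else p.1
  have hH : ∀ p, γ p ∈ L.space → (H p).1 = γ p := fun p hp => by simp only [H, dif_pos hp]
  refine cubeExt_of_contraction (A := A) H ⟨barycenter σ.1, barycenter_mem_space σ.2⟩ ?_ ?_ ?_
    (fun x hx => Subtype.ext ?_) (fun x hx => Subtype.ext ?_) d
  · exact fun v hv => mem_support.2 (hc v hv).ne'
  · rw [Topology.IsInducing.subtypeVal.continuousOn_iff]
    refine ContinuousOn.congr (f := γ) ?_ fun p hp => hH p (hγ p hp)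
    refine Continuous.continuousOn (continuous_pi fun v => ?_)
    have : Continuous fun p : L.space × ℝ => p.1.1 v :=
      (continuous_apply v).comp (continuous_subtype_val.comp continuous_fst)
    fun_prop
  · rintro p hp v hv
    refine mem_support.2 ?_
    rw [hH p (hγ p hp)]
    obtain ⟨hx, ht0, ht1⟩ := hp
    have h1 : 0 < p.1.1 v := lt_of_le_of_ne (p.1.2.1 v) (mem_support.1 (hx hv)).symm
    have h2 := hc v hv
    have : 0 < γ p v := by
      rcases ht0.eq_or_lt with h | h
      · simp only [γ, ← h]; simpa using h1
      · exact add_pos_of_nonneg_of_pos (mul_nonneg (by simpa using ht1) h1.le) (mul_pos h h2)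
    exact this.ne'
  · rw [hH _ (hγ (x, 0) ⟨hx, by simp⟩)]; ext v; simp [γ]
  · rw [hH _ (hγ (x, 1) ⟨hx, by simp⟩)]; ext v; simp [γ]

end ASC

theorem IsConn.nonempty_face {V : Type} [DecidableEq V] {L : ASC V} {n : ℤ} (h : IsConn L.space n)
    (hn : -1 ≤ n) : Nonempty L.Face :=
  (h.1 hn).map ASC.support

theorem IsConn.posetExt_face {V : Type} [DecidableEq V] {L : ASC V} {n : ℤ} (h : IsConn L.space n)
    {d : ℕ} (hd : (d : ℤ) ≤ n + 1) : PosetExt L.Faceᵒᵈ d := by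
  have := h.1 (by omega)
  have := h.nonempty_face (by omega)
  exact PosetExt.orderDual (CubeExt.map_of_fibers ASC.continuous_support
    ASC.cubeExt_support_preimage ((isConn_iff_cubeExt.1 h).2 d hd))

namespace ASC

variable {V : Type} [DecidableEq V] (K : ASC V)

/-- Pairs of an injective word and a set of letters, disjoint and jointly spanning a simplex. -/
structure Mixed where
  word : List V
  face : Finset V
  nodup : word.Nodup
  disjoint : Disjoint word.toFinset face
  union_mem : word.toFinset ∪ face ∈ K.faces

variable {K}

namespace Mixed

/-- Passing to a subword and a subset makes a pair larger. -/
instance : Preorder K.Mixed where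
  le p q := q.word.Sublist p.word ∧ q.face ⊆ p.face
  le_refl p := ⟨.refl _, subset_rfl⟩
  le_trans p q r h h' := ⟨h'.1.trans h.1, h'.2.trans h.2⟩

instance : TopologicalSpace K.Mixed := Topology.upperSet _

instance : Topology.IsUpperSet K.Mixed := ⟨rfl⟩

theorem le_def {p q : K.Mixed} : p ≤ q ↔ q.word.Sublist p.word ∧ q.face ⊆ p.face := Iff.rfl

open Classical in
/-- Replace the word of a pair, if possible. -/
noncomputable def withWord (p : K.Mixed) (b : List V) : K.Mixed :=
  if h : b.Nodup ∧ Disjoint b.toFinset p.face ∧ b.toFinset ∪ p.face ∈ K.faces then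
    ⟨b, p.face, h.1, h.2.1, h.2.2⟩ else p

theorem face_withWord (p : K.Mixed) (b : List V) : (p.withWord b).face = p.face := by
  unfold withWord; split_ifs <;> rfl

theorem word_withWord {p : K.Mixed} {b : List V} (hb : b.Nodup) (hd : Disjoint b.toFinset p.face)
    (hK : b.toFinset ∪ p.face ∈ K.faces) : (p.withWord b).word = b := by
  rw [withWord, dif_pos ⟨hb, hd, hK⟩]

/-- The pairs whose word is a subword of `u` and whose set of letters is in the link of `w`. -/
def below (u w : List V) : Set K.Mixed :=
  {p | p.word.Sublist u ∧ Disjoint w.toFinset p.face ∧ w.toFinset ∪ p.face ∈ K.faces}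

theorem isOpen_below {u w : List V} (hw : w ≠ []) : IsOpen (below u w : Set K.Mixed) := by
  rw [Topology.IsUpperSet.isOpen_iff_isUpperSet]
  rintro p q ⟨h1, h2⟩ ⟨h3, h4, h5⟩
  exact ⟨h1.trans h3, h4.mono_right h2, K.down_closed h5 (Finset.union_subset_union_right h2)
    (.inl (by simpa using hw))⟩

variable {u w : List V}

theorem word_withWord_of_sublist {p : K.Mixed} {b : List V} (hp : p ∈ below u w)
    (hw : w.Nodup) (hb : b.Sublist w) (hne : b ≠ []) : (p.withWord b).word = b := by
  have h : b.toFinset ⊆ w.toFinset := fun x hx => by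
    simpa using hb.subset (by simpa using hx)
  exact word_withWord (hb.nodup hw) (hp.2.1.mono_left h) (K.down_closed hp.2.2
    (Finset.union_subset_union_left h) (.inl (by simpa using hne)))

/-- The pair of a word and the empty set. -/
def ofWord (b : List V) (hb : b.Nodup) (h : b.toFinset ∈ K.faces) : K.Mixed :=
  ⟨b, ∅, hb, by simp, by simpa using h⟩

theorem toFinset_mem_of_sublist {b : List V} (hb : b.Sublist w) (hb' : b ≠ [])
    (hw : w.toFinset ∈ K.faces) : b.toFinset ∈ K.faces :=
  K.down_closed hw (fun x hx => by simpa using hb.subset (by simpa using hx)) (by simpa using hb')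

theorem cubeExt_below (hw : w.Nodup) (hwK : w.toFinset ∈ K.faces) (hu : u.Sublist w)
    (hu' : u ≠ []) (d : ℕ) : CubeExt (below u w : Set K.Mixed) d := by
  have hφ : ∀ p ∈ (below u w : Set K.Mixed), (p.withWord u).word = u := fun p hp =>
    word_withWord_of_sublist hp hw hu hu'
  refine cubeExt_upper_of_zigzag
    (c := ofWord u (hu.nodup hw) (toFinset_mem_of_sublist hu hu' hwK)) ?_
    (fun p => p.withWord u) ?_ ?_ ?_ ?_ d
  · exact ⟨.refl _, by simp [ofWord], by simpa [ofWord] using hwK⟩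
  · intro p hp
    change _ ∧ _
    rw [hφ p hp, face_withWord]
    exact ⟨.refl _, hp.2⟩
  · intro p hp q hq hpq
    simp only [le_def, hφ p hp, hφ q hq, face_withWord]
    exact ⟨.refl _, hpq.2⟩
  · intro p hp
    simp only [le_def, hφ p hp, face_withWord]
    exact ⟨hp.1, subset_rfl⟩
  · intro p hp
    simp only [le_def, hφ p hp, face_withWord]
    exact ⟨.refl _, by simp [ofWord]⟩

/-- The pairs whose word is a proper subword of `u`. -/
def properBelow (u w : List V) : Set K.Mixed := below u w ∩ {p | p.word ≠ u}

theorem cubeExt_range_face {d : ℕ} {F : Set (Finset V)} (hF : F ⊆ K.faces)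
    (hne : F.Nonempty) (h : PosetExt {τ // τ ∈ F}ᵒᵈ d) :
    CubeExt {p : K.Mixed | p.word = [] ∧ p.face ∈ F} d := by
  let e : Topology.WithUpperSet {τ // τ ∈ F}ᵒᵈ → K.Mixed := fun τ =>
    ⟨[], (OrderDual.ofDual (Topology.WithUpperSet.ofUpperSet τ)).1, by simp, by simp,
      by simpa using hF (OrderDual.ofDual (Topology.WithUpperSet.ofUpperSet τ)).2⟩
  have : Nonempty (Topology.WithUpperSet {τ // τ ∈ F}ᵒᵈ) := ⟨⟨_, hne.some_mem⟩⟩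
  have hr : {p : K.Mixed | p.word = [] ∧ p.face ∈ F} = range e := by
    ext p
    constructor
    · rintro ⟨h1, h2⟩
      obtain ⟨a, τ, _, _, _⟩ := p
      obtain rfl : a = [] := h1
      exact ⟨⟨τ, h2⟩, rfl⟩
    · rintro ⟨τ, rfl⟩
      exact ⟨rfl, (OrderDual.ofDual (Topology.WithUpperSet.ofUpperSet τ)).2⟩
  rw [hr]
  exact h.range_orderEmbedding e fun a b => ⟨fun h => h.2, fun h => ⟨.refl _, h⟩⟩

theorem cubeExt_properBelow (hw : w.Nodup) (hwK : w.toFinset ∈ K.faces) {M : ℕ}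
    (hM : ∀ d < M, (K.link w.toFinset).faces.Nonempty ∧ PosetExt (K.link w.toFinset).Faceᵒᵈ d) :
    ∀ u : List V, u.Sublist w → u ≠ [] → ∀ d, d + 1 < M + u.length →
      CubeExt (properBelow u w : Set K.Mixed) d
  | [], _, h, _, _ => (h rfl).elim
  | [x], hu, _, d, hd => by
    have hd' : d < M := by simpa using hd
    have : (properBelow [x] w : Set K.Mixed) =
        {p : K.Mixed | p.word = [] ∧ p.face ∈ (K.link w.toFinset).faces} := by
      ext p
      constructor
      · rintro ⟨⟨h1, h2, h3⟩, h4⟩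
        have h5 : p.word = [] := (List.sublist_singleton.1 h1).resolve_right h4
        have h6 := p.union_mem
        rw [h5] at h6
        exact ⟨h5, by simpa using h6, h2, h3⟩
      · rintro ⟨h1, h2, h3, h4⟩
        exact ⟨⟨by simp [h1], h3, h4⟩, by simp [h1]⟩
    rw [this]
    exact cubeExt_range_face (fun τ h => h.1) (hM d hd').1 (hM d hd').2
  | v :: v' :: u, hu, _, d, hd => by
    set u' := v' :: u with hu'
    have hu'w : u'.Sublist w := (List.sublist_cons_self v u').trans hu
    have hvu : v ∉ u' := (List.nodup_cons.1 (hu.nodup hw)).1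
    let A : Set K.Mixed := below (v :: u') w ∩ {p | p.word.erase v ≠ u'}
    have herase : ∀ p ∈ (below (v :: u') w : Set K.Mixed), (p.word.erase v).Sublist u' := fun p hp => by
      simpa using hp.1.erase v
    have hcons : ∀ p ∈ (below (v :: u') w : Set K.Mixed), p.word.Sublist (v :: p.word.erase v) := fun p hp => by
      rcases List.sublist_cons_iff.1 hp.1 with h | ⟨a, ha, -⟩
      · rw [List.erase_of_not_mem fun h' => hvu (h.subset h')]
        exact List.sublist_cons_self _ _
      · rw [ha, List.erase_cons_head]
    have hφ : ∀ p ∈ A, (p.withWord (v :: p.word.erase v)).word = v :: p.word.erase v :=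
      fun p hp => word_withWord_of_sublist hp.1 hw (((herase p hp.1).cons_cons v).trans hu)
        (List.cons_ne_nil _ _)
    have hvw : [v].Sublist w := (List.singleton_sublist.2 List.mem_cons_self).trans hu
    have hA : ∀ d, CubeExt A d := by
      refine cubeExt_upper_of_zigzag
        (c := ofWord [v] (by simp) (toFinset_mem_of_sublist hvw (by simp) hwK)) ?_
        (fun p => p.withWord (v :: p.word.erase v)) ?_ ?_ ?_ ?_
      · refine ⟨⟨List.singleton_sublist.2 List.mem_cons_self, ?_, ?_⟩, ?_⟩
        · simp [ofWord]
        · simpa [ofWord] using hwK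
        · simp [ofWord, hu']
      · intro p hp
        change (_ ∧ _) ∧ _ ≠ _
        rw [hφ p hp, face_withWord, List.erase_cons_head]
        exact ⟨⟨(herase p hp.1).cons_cons v, hp.1.2⟩, hp.2⟩
      · intro p hp q hq hpq
        simp only [le_def, hφ p hp, hφ q hq, face_withWord]
        exact ⟨(hpq.1.erase v).cons_cons v, hpq.2⟩
      · intro p hp
        simp only [le_def, hφ p hp, face_withWord]
        exact ⟨hcons p hp.1, subset_rfl⟩
      · intro p hp
        simp only [le_def, hφ p hp, face_withWord]
        exact ⟨by simp [ofWord], by simp [ofWord]⟩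
    have hw0 : w ≠ [] := by rintro rfl; simp at hu
    have hAo : IsOpen A := by
      rw [Topology.IsUpperSet.isOpen_iff_isUpperSet]
      rintro p q hpq ⟨h1, h2⟩
      refine ⟨Topology.IsUpperSet.isOpen_iff_isUpperSet.1 (isOpen_below hw0) hpq h1, fun h => h2 ?_⟩
      exact (herase p h1).eq_of_length_le (h ▸ (hpq.1.erase v).length_le)
    have hu1 : (properBelow (v :: u') w : Set K.Mixed) = A ∪ ⋃ _ : Unit, below u' w := by
      rw [iUnion_const]
      ext p
      constructor
      · rintro ⟨h1, h2⟩
        by_cases h : p.word.erase v = u'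
        · rcases List.sublist_cons_iff.1 h1.1 with h' | ⟨a, ha, -⟩
          · exact .inr ⟨h', h1.2⟩
          · rw [ha, List.erase_cons_head] at h
            exact (h2 (by rw [ha, h])).elim
        · exact .inl ⟨h1, h⟩
      · rintro (⟨h1, h2⟩ | ⟨h1, h2⟩)
        · exact ⟨h1, fun h => h2 (by rw [h, List.erase_cons_head])⟩
        · exact ⟨⟨h1.trans (List.sublist_cons_self v u'), h2⟩,
            fun h => hvu (h1.subset (h ▸ List.mem_cons_self))⟩
    have hu2 : A ∩ below u' w = properBelow u' w := by
      ext p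
      constructor
      · rintro ⟨⟨-, h1⟩, h2⟩
        exact ⟨h2, by rwa [mem_ofPred_eq, List.erase_of_not_mem fun h' => hvu (h2.1.subset h')] at h1⟩
      · rintro ⟨h2, h1⟩
        refine ⟨⟨⟨h2.1.trans (List.sublist_cons_self v u'), h2.2⟩, ?_⟩, h2⟩
        rwa [mem_ofPred_eq, List.erase_of_not_mem fun h' => hvu (h2.1.subset h')]
    rw [hu1]
    refine CubeExt.union_iUnion hAo (fun _ => isOpen_below hw0) (fun i j h => (h rfl).elim) (hA d)
      (fun _ d _ => cubeExt_below hw hwK hu'w (by simp [hu']) d) fun _ d' hd' => ?_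
    rw [hu2]
    exact cubeExt_properBelow hw hwK hM u' hu'w (by simp [hu']) d' (by simp at hd ⊢; omega)

/-- The pairs whose word has at most `k` letters. -/
def lengthLE (K : ASC V) (k : ℕ) : Set K.Mixed := {p | p.word.length ≤ k}

theorem isOpen_lengthLE (k : ℕ) : IsOpen (lengthLE K k) := by
  rw [Topology.IsUpperSet.isOpen_iff_isUpperSet]
  exact fun p q hpq hp => hpq.1.length_le.trans hp

theorem cubeExt_lengthLE {n : ℤ} (h : WCM K n) (k d : ℕ) (hd : (d : ℤ) ≤ n) :
    CubeExt (lengthLE K k) d := by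
  induction k with
  | zero =>
    have hne := h.1.nonempty_face (by omega)
    have : lengthLE K 0 = {p : K.Mixed | p.word = [] ∧ p.face ∈ K.faces} := by
      ext p
      have h6 := p.union_mem
      simp only [lengthLE, mem_ofPred_eq, Nat.le_zero, List.length_eq_zero_iff]
      exact ⟨fun h => ⟨h, by simpa [h] using h6⟩, fun h => h.1⟩
    rw [this]
    exact cubeExt_range_face subset_rfl ⟨_, hne.some.2⟩ (h.1.posetExt_face (by omega))
  | succ k ih =>
    let ι := {w : List V // w.length = k + 1 ∧ w.Nodup ∧ w.toFinset ∈ K.faces}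
    have hne : ∀ w : ι, w.1 ≠ [] := fun w hw => by simpa [hw] using w.2.1
    have : lengthLE K (k + 1) = lengthLE K k ∪ ⋃ w : ι, below w.1 w.1 := by
      ext p
      rw [mem_union, mem_iUnion]
      constructor
      · intro hp
        rcases Nat.le_succ_iff.1 hp with hp | hp
        · exact .inl hp
        · exact .inr ⟨⟨p.word, hp, p.nodup, K.down_closed p.union_mem Finset.subset_union_left
            ((List.toFinset_nonempty_iff _).2 (by rintro h; simp [h] at hp))⟩, .refl _, p.disjoint,
            p.union_mem⟩
      · rintro (hp | ⟨w, hp⟩)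
        · exact Nat.le_succ_of_le hp
        · exact hp.1.length_le.trans w.2.1.le
    rw [this]
    refine CubeExt.union_iUnion (isOpen_lengthLE k) (fun w => isOpen_below (hne w)) ?_ ih
      (fun w d _ => cubeExt_below w.2.2.1 w.2.2.2 (.refl _) (hne w) d) fun w d' hd' => ?_
    · rintro w w' hww p ⟨h1, h2⟩
      change p.word.length ≤ k
      by_contra hlt
      have h3 := h1.1.eq_of_length_le (by have := w.2.1; omega)
      have h4 := h2.1.eq_of_length_le (by have := w'.2.1; omega)
      exact hww (Subtype.ext (h3.symm.trans h4))
    · have : lengthLE K k ∩ below w.1 w.1 = properBelow w.1 w.1 := by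
        ext p
        constructor
        · rintro ⟨h1, h2⟩
          refine ⟨h2, fun h => ?_⟩
          have h1' : p.word.length ≤ k := h1
          have := w.2.1
          rw [h] at h1'
          omega
        · rintro ⟨h2, h1⟩
          refine ⟨?_, h2⟩
          change p.word.length ≤ k
          by_contra hlt
          exact h1 (h2.1.eq_of_length_le (by have := w.2.1; omega))
      rw [this]
      have hcard : w.1.toFinset.card = k + 1 := by
        rw [List.toFinset_card_of_nodup w.2.2.1, w.2.1]
      have hl := h.2 _ w.2.2.2
      rw [hcard] at hl
      refine cubeExt_properBelow (M := (n - k).toNat) w.2.2.1 w.2.2.2 (fun e he => ?_) _ (.refl _)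
        (hne w) _ (by have := w.2.1; omega)
      have hne' := hl.nonempty_face (by push_cast; omega)
      exact ⟨⟨_, hne'.some.2⟩, hl.posetExt_face (by push_cast; omega)⟩

theorem cubeExt_univ {n : ℤ} (h : WCM K n) (d : ℕ) (hd : (d : ℤ) ≤ n) :
    CubeExt (univ : Set K.Mixed) d := by
  have : (univ : Set K.Mixed) = ⋃ k, lengthLE K k :=
    (eq_univ_of_forall fun p => mem_iUnion.2 ⟨_, le_refl p.word.length⟩).symm
  rw [this]
  exact CubeExt.iUnion_nat isOpen_lengthLE (fun a b hab p hp => le_trans hp hab)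
    fun k => cubeExt_lengthLE h k d hd

end Mixed

end ASC

theorem sort_sublist_sort {α : Type*} [LinearOrder α] {s t : Finset α} (h : s ⊆ t) :
    s.sort.Sublist t.sort :=
  List.sublist_of_subperm_of_pairwise
    ((Finset.sort_nodup s (· ≤ ·)).subperm fun x hx => by simpa using h (by simpa using hx))
    (Finset.pairwise_sort s (· ≤ ·)) (Finset.pairwise_sort t (· ≤ ·))

namespace ASC

variable {V : Type} [DecidableEq V] (K : ASC V)

/-- Injective words whose letters span a simplex. -/
structure Word where
  word : List V
  ne_nil : word ≠ []
  nodup : word.Nodup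
  mem : word.toFinset ∈ K.faces

variable {K}

namespace Word

@[ext]
theorem ext {p q : K.Word} (h : p.word = q.word) : p = q := by
  cases p; cases q; cases h; rfl

/-- The subword order. -/
instance : Preorder K.Word where
  le p q := p.word.Sublist q.word
  le_refl p := .refl _
  le_trans p q r h h' := h.trans h'

theorem le_def {p q : K.Word} : p ≤ q ↔ p.word.Sublist q.word := Iff.rfl

end Word

theorem Word.nonempty [Nonempty K.Mixed] : Nonempty K.Word := by
  obtain ⟨v, hv⟩ := K.nonempty_of_mem (Classical.arbitrary K.Mixed).union_mem
  exact ⟨[v], by simp, by simp, K.down_closed (Classical.arbitrary K.Mixed).union_mem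
    (by simpa using hv) (by simp)⟩

/-- List the set of letters in increasing order after the word. -/
def Mixed.toWord [LinearOrder V] (p : K.Mixed) : K.Word where
  word := p.word ++ p.face.sort
  ne_nil h := by
    have h1 := K.nonempty_of_mem p.union_mem
    have h2 : p.face.sort.toFinset = p.face := Finset.sort_toFinset _ _
    rw [List.append_eq_nil_iff] at h
    rw [← h2, h.1, h.2] at h1
    simp at h1
  nodup := by
    refine p.nodup.append (Finset.sort_nodup _ _) fun x hx hx' => ?_
    exact Finset.disjoint_left.1 p.disjoint (by simpa using hx) (by simpa using hx')
  mem := by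
    rw [List.toFinset_append, Finset.sort_toFinset]
    exact p.union_mem

theorem nonempty_mixed {n : ℤ} (h : WCM K n) (hn : 0 ≤ n) : Nonempty K.Mixed := by
  obtain ⟨τ, hτ⟩ := h.1.nonempty_face (by omega)
  exact ⟨[], τ, by simp, by simp, by simpa using hτ⟩

theorem posetExt_word {n : ℤ} (h : WCM K n) (d : ℕ) (hd : (d : ℤ) ≤ n) : PosetExt K.Word d := by
  obtain ⟨_⟩ : Nonempty (LinearOrder V) := ⟨by classical exact linearOrderOfSTO WellOrderingRel⟩
  let r : K.Mixed →o K.Wordᵒᵈ :=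
    ⟨fun p => OrderDual.toDual p.toWord, fun p q hpq =>
      (hpq.1.append (sort_sublist_sort hpq.2) : q.toWord.word.Sublist p.toWord.word)⟩
  let i : K.Wordᵒᵈ →o K.Mixed :=
    ⟨fun w => .ofWord w.ofDual.word w.ofDual.nodup w.ofDual.mem, fun w w' hw => ⟨hw, subset_rfl⟩⟩
  have h1 : PosetExt K.Mixed d := Mixed.cubeExt_univ h d hd
  have h2 : PosetExt K.Wordᵒᵈ d := h1.of_retract r i fun w => by
    refine congrArg OrderDual.toDual (Word.ext ?_)
    change w.ofDual.word ++ (∅ : Finset V).sort = w.ofDual.word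
    simp
  have : Nonempty K.Mixed := nonempty_mixed h (by omega)
  have : Nonempty K.Wordᵒᵈ := Word.nonempty
  exact h2.orderDual

end ASC

namespace ASC

theorem faceInclude_apply {k n : ℕ} {e : Fin k → Fin n} (he : Function.Injective e)
    (w : Fin k → ℝ) (j : Fin k) : faceInclude e w (e j) = w j := by
  have : e ⁻¹' {e j} = {j} := by ext; simp [he.eq_iff]
  simp [faceInclude, this]

theorem faceInclude_of_notMem {k n : ℕ} {e : Fin k → Fin n} (w : Fin k → ℝ) {i : Fin n}
    (hi : i ∉ range e) : faceInclude e w i = 0 := by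
  have : e ⁻¹' {i} = ∅ := by
    ext j
    simpa using fun h => hi ⟨j, h⟩
  simp [faceInclude, this]

theorem faceInclude_comp {k n : ℕ} {e : Fin k → Fin n} (he : Function.Injective e)
    {x : Fin n → ℝ} (hx : ∀ i ∉ range e, x i = 0) : faceInclude e (x ∘ e) = x := by
  ext i
  by_cases hi : i ∈ range e
  · obtain ⟨j, rfl⟩ := hi
    exact faceInclude_apply he _ j
  · rw [faceInclude_of_notMem _ hi, hx i hi]

/-- The letters carrying nonzero weight, in order. -/
noncomputable def suppList {V : Type} {k : ℕ} (f : Fin k → V) (x : Fin k → ℝ) : List V :=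
  ((List.finRange k).filter fun i => x i ≠ 0).map f

section suppList

variable {V : Type} {k : ℕ} {f : Fin k → V} {x y : Fin k → ℝ}

theorem mem_suppList {v : V} : v ∈ suppList f x ↔ ∃ i, x i ≠ 0 ∧ f i = v := by
  simp [suppList]

theorem nodup_suppList (hf : Function.Injective f) : (suppList f x).Nodup :=
  ((List.nodup_finRange k).filter _).map hf

theorem suppList_sublist (h : ∀ i, x i ≠ 0 → y i ≠ 0) :
    (suppList f x).Sublist (suppList f y) :=
  (List.monotone_filter_right _ (by simpa using h)).map f

theorem sublist_suppList (hf : Function.Injective f) {w : List V}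
    (hw : w.Sublist (suppList f x)) (hy : ∀ i, f i ∈ w → y i ≠ 0) :
    w.Sublist (suppList f y) := by
  classical
  let z : Fin k → ℝ := fun i => if f i ∈ w then 1 else 0
  have hz : ∀ i, z i ≠ 0 ↔ f i ∈ w := fun i => by simp [z]
  have h1 : w = suppList f z := by
    have h2 := hw.filter (· ∈ w)
    rw [List.filter_eq_self.2 (by simp)] at h2
    have h3 : (suppList f x).filter (· ∈ w) = suppList f z := by
      simp only [suppList, List.filter_map, List.filter_filter]
      congr 1
      refine List.filter_congr fun i _ => ?_
      have : f i ∈ w → x i ≠ 0 := fun h => by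
        obtain ⟨j, hj, hji⟩ := mem_suppList.1 (hw.subset h)
        rwa [← hf hji]
      by_cases h : f i ∈ w
      · simp [h, this h, z]
      · simp [h, z]
    rw [h3] at h2
    exact h2.eq_of_length_le <| (List.subperm_of_subset (nodup_suppList hf) fun v hv => by
      obtain ⟨i, hi, rfl⟩ := mem_suppList.1 hv
      exact (hz i).1 hi).length_le
  rw [h1]
  exact suppList_sublist fun i hi => hy i ((hz i).1 hi)

theorem suppList_faceInclude {j : ℕ} {e : Fin j → Fin k} (he : StrictMono e) (w : Fin j → ℝ) :
    suppList f (faceInclude e w) = suppList (f ∘ e) w := by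
  have : ((List.finRange k).filter fun i => faceInclude e w i ≠ 0) =
      ((List.finRange j).filter fun i => w i ≠ 0).map e := by
    refine List.Perm.eq_of_pairwise (le := (· < ·)) (fun a b _ _ h h' => (h.asymm h').elim)
      ((List.pairwise_lt_finRange k).filter _)
      (((List.pairwise_lt_finRange j).filter _).map e fun _ _ h => he h) ?_
    rw [List.perm_ext_iff_of_nodup ((List.nodup_finRange k).filter _)
      (((List.nodup_finRange j).filter _).map he.injective)]
    intro i
    by_cases hi : i ∈ range e
    · obtain ⟨a, rfl⟩ := hi
      simp [faceInclude_apply he.injective, he.injective.eq_iff]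
    · simp only [List.mem_filter, faceInclude_of_notMem w hi, List.mem_map]
      simpa using fun a _ h => hi ⟨a, h⟩
  simp only [suppList, this, List.map_map]

end suppList

variable {V : Type} [DecidableEq V] {K : ASC V}

/-- The word of a point of the disjoint union of simplices. -/
noncomputable def ptWord (p : OrdPts K) : K.Word where
  word := suppList p.1.2.1 p.2.1
  ne_nil h := by
    have h1 : ∀ i, p.2.1 i = 0 := fun i => by
      by_contra hi
      exact List.ne_nil_of_mem (mem_suppList.2 ⟨i, hi, rfl⟩) h
    have h2 := p.2.2.2
    simp [h1] at h2
  nodup := nodup_suppList p.1.2.2.1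
  mem := by
    have h1 : ∃ i, p.2.1 i ≠ 0 := by
      by_contra! h1
      have h2 := p.2.2.2
      simp [h1] at h2
    obtain ⟨i, hi⟩ := h1
    refine K.down_closed p.1.2.2.2 (fun v hv => ?_) ⟨p.1.2.1 i, ?_⟩
    · obtain ⟨i, -, rfl⟩ := mem_suppList.1 (List.mem_toFinset.1 hv)
      simp
    · exact List.mem_toFinset.2 (mem_suppList.2 ⟨i, hi, rfl⟩)

theorem ptWord_eq_of_ordRel {p q : OrdPts K} (h : OrdRel K p q) : ptWord p = ptWord q := by
  obtain ⟨j, k, f, hf, e, he, w, hmem, hcomp, rfl, rfl⟩ := h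
  exact Word.ext (suppList_faceInclude he w.1)

/-- The word of a point of the realization. -/
noncomputable def realWord : OrdRealization K → Topology.WithUpperSet K.Word :=
  Quot.lift (fun p => Topology.WithUpperSet.toUpperSet (ptWord p)) fun _ _ h =>
    congrArg _ (ptWord_eq_of_ordRel h)

theorem continuous_realWord : Continuous (realWord (K := K)) := by
  refine continuous_quot_lift _ (continuous_sigma fun p => ?_)
  rw [← continuousOn_univ, continuousOn_upper_iff]
  intro x _
  rw [nhdsWithin_univ]
  have : ∀ i, ∀ᶠ y : stdSimplexSet (p.1 + 1) in 𝓝 x, x.1 i ≠ 0 → y.1 i ≠ 0 := fun i => by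
    by_cases hi : x.1 i = 0
    · simp [hi]
    · have hc : Continuous fun y : stdSimplexSet (p.1 + 1) => y.1 i :=
        (continuous_apply i).comp continuous_subtype_val
      filter_upwards [hc.continuousAt.eventually_ne hi] with y hy _ using hy
  filter_upwards [eventually_all.2 this] with y hy
  exact suppList_sublist hy

end ASC

end

section

open Set Topology Filter unitInterval

namespace ASC

theorem segment_mem_stdSimplexSet {k : ℕ} {x y : Fin k → ℝ} (hx : x ∈ stdSimplexSet k)
    (hy : y ∈ stdSimplexSet k) (t : I) :
    (fun i => (1 - (t : ℝ)) * x i + t * y i) ∈ stdSimplexSet k := by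
  refine ⟨fun i => add_nonneg (mul_nonneg (sub_nonneg.2 t.2.2) (hx.1 i))
    (mul_nonneg t.2.1 (hy.1 i)), ?_⟩
  rw [Finset.sum_add_distrib, ← Finset.mul_sum, ← Finset.mul_sum, hx.2, hy.2]
  ring

theorem exists_strictMono_of_sublist {V : Type} {k m : ℕ} {f : Fin k → V} {x : Fin k → ℝ} {w : List V}
    (h : w.Sublist (suppList f x)) (hm : m = w.length) :
    ∃ e : Fin m → Fin k, StrictMono e ∧ ∀ i, w.get (i.cast hm) = f (e i) := by
  subst hm
  have h1 : w.Sublist (List.ofFn f) := by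
    rw [List.ofFn_eq_map]
    exact h.trans (List.filter_sublist.map f)
  obtain ⟨e, he⟩ := List.sublist_iff_exists_fin_orderEmbedding_get_eq.1 h1
  refine ⟨fun i => (e i).cast (List.length_ofFn), fun i j hij => ?_, fun i => ?_⟩
  · simpa using hij
  · exact (he i).trans (List.get_ofFn f (e i))

variable {V : Type} [DecidableEq V] {K : ASC V}

/-- Equal weights on the letters of a word. -/
noncomputable def wordBarycenter {k : ℕ} (w : List V) (f : Fin k → V) : Fin k → ℝ :=
  fun i => if f i ∈ w then (w.length : ℝ)⁻¹ else 0

theorem wordBarycenter_mem {k : ℕ} {w : List V} (hw : w.Nodup) (hw' : w ≠ []) {f : Fin k → V}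
    (hf : Function.Injective f) (h : ∀ v ∈ w, v ∈ range f) :
    wordBarycenter w f ∈ stdSimplexSet k := by
  refine ⟨fun i => by unfold wordBarycenter; positivity, ?_⟩
  have h1 : (Finset.univ.filter fun i => f i ∈ w).image f = w.toFinset := by
    ext v
    simp only [Finset.mem_image, Finset.mem_filter, Finset.mem_univ, true_and, List.mem_toFinset]
    constructor
    · rintro ⟨i, hi, rfl⟩
      exact hi
    · intro hv
      obtain ⟨i, rfl⟩ := h v hv
      exact ⟨i, hv, rfl⟩
  have h2 : (Finset.univ.filter fun i => f i ∈ w).card = w.length := by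
    rw [← Finset.card_image_of_injective _ hf, h1, List.toFinset_card_of_nodup hw]
  have h3 : (w.length : ℝ) ≠ 0 := by simpa using hw'
  simp only [wordBarycenter, ← Finset.sum_filter, Finset.sum_const, h2, nsmul_eq_mul]
  exact mul_inv_cancel₀ h3

theorem ordRealization_mk_eq {j k : ℕ} {f : Fin (k + 1) → V}
    (hf : Function.Injective f ∧ Finset.univ.image f ∈ K.faces) {g : Fin (j + 1) → V}
    (hg : Function.Injective g ∧ Finset.univ.image g ∈ K.faces) {e : Fin (j + 1) → Fin (k + 1)}
    (he : StrictMono e) (hge : ∀ i, g i = f (e i)) (x : stdSimplexSet (k + 1))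
    (y : stdSimplexSet (j + 1)) (hxy : ∀ i, y.1 i = x.1 (e i))
    (hx : ∀ i ∉ range e, x.1 i = 0) :
    (Quot.mk _ ⟨⟨k, f, hf⟩, x⟩ : OrdRealization K) = Quot.mk _ ⟨⟨j, g, hg⟩, y⟩ := by
  obtain rfl : g = f ∘ e := funext hge
  have h1 : x.1 = faceInclude e y.1 := by
    rw [show y.1 = x.1 ∘ e from funext hxy, faceInclude_comp he.injective hx]
  obtain ⟨x, hx'⟩ := x
  obtain rfl : x = faceInclude e y.1 := h1
  exact Quot.sound ⟨j, k, f, hf, e, he, y, hx', hg, rfl, rfl⟩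

open Classical in
/-- Slide a point towards the barycenter of a face. -/
noncomputable def slide (w : K.Word) (p : OrdPts K) : C(I, OrdPts K) :=
  if h : ∀ v ∈ w.word, v ∈ range p.1.2.1 then
    { toFun t := ⟨p.1, ⟨_, segment_mem_stdSimplexSet p.2.2
        (wordBarycenter_mem w.nodup w.ne_nil p.1.2.2.1 h) t⟩⟩
      continuous_toFun := by
        refine continuous_sigmaMk.comp (Continuous.subtype_mk ?_ _)
        fun_prop }
  else .const _ p

theorem slide_apply {w : K.Word} {p : OrdPts K} (h : ∀ v ∈ w.word, v ∈ range p.1.2.1) (t : I) :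
    slide w p t = ⟨p.1, ⟨_, segment_mem_stdSimplexSet p.2.2
        (wordBarycenter_mem w.nodup w.ne_nil p.1.2.2.1 h) t⟩⟩ := by
  rw [slide, dif_pos h]
  rfl

theorem continuous_slide (w : K.Word) : Continuous (slide w) := by
  refine continuous_sigma fun s => ?_
  by_cases h : ∀ v ∈ w.word, v ∈ range s.2.1
  · refine ContinuousMap.continuous_of_continuous_uncurry _ ?_
    have : (Function.uncurry fun (x : stdSimplexSet (s.1 + 1)) t => slide w ⟨s, x⟩ t) =
        fun q : stdSimplexSet (s.1 + 1) × I => ⟨s, ⟨_, segment_mem_stdSimplexSet q.1.2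
          (wordBarycenter_mem w.nodup w.ne_nil s.2.2.1 h) q.2⟩⟩ := by
      ext q
      exact slide_apply (p := ⟨s, q.1⟩) h q.2
    refine (continuous_sigmaMk.comp (Continuous.subtype_mk ?_ _)).congr fun q => (congrFun this q).symm
    refine continuous_pi fun i => ?_
    have h1 : Continuous fun q : stdSimplexSet (s.1 + 1) × I => q.1.1 i :=
      (continuous_apply i).comp (continuous_subtype_val.comp continuous_fst)
    have h2 : Continuous fun q : stdSimplexSet (s.1 + 1) × I => (q.2 : ℝ) :=
      continuous_subtype_val.comp continuous_snd
    exact ((continuous_const.sub h2).mul h1).add (h2.mul continuous_const)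
  · have : (fun x => slide w ⟨s, x⟩) = fun x => ContinuousMap.const I (⟨s, x⟩ : OrdPts K) := by
      ext1 x
      exact dif_neg h
    rw [this]
    exact ContinuousMap.continuous_const'.comp continuous_sigmaMk

theorem mem_range_of_le_ptWord {w : K.Word} {p : OrdPts K} (h : w ≤ ptWord p) :
    ∀ v ∈ w.word, v ∈ range p.1.2.1 := fun v hv => by
  obtain ⟨i, -, rfl⟩ := mem_suppList.1 ((Word.le_def.1 h).subset hv)
  exact ⟨i, rfl⟩

/-- The quotient map onto the realization. -/
def ordMk : C(OrdPts K, OrdRealization K) := ⟨Quot.mk _, continuous_quot_mk⟩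

theorem ordMk_surjective : Function.Surjective (ordMk : OrdPts K → OrdRealization K) :=
  Quot.exists_rep

theorem ordMk_slide_eq {w : K.Word} {p q : OrdPts K} (h : OrdRel K p q) (hw : w ≤ ptWord q)
    (t : I) : ordMk (slide w p t) = ordMk (slide w q t) := by
  have hw' : w ≤ ptWord p := by rwa [ptWord_eq_of_ordRel h]
  rw [slide_apply (mem_range_of_le_ptWord hw), slide_apply (mem_range_of_le_ptWord hw')]
  have hq := mem_range_of_le_ptWord hw
  obtain ⟨j, k, f, hf, e, he, u, hmem, hcomp, rfl, rfl⟩ := h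
  refine ordRealization_mk_eq hf hcomp he (fun _ => rfl) _ _ (fun i => ?_) fun i hi => ?_
  · simp [faceInclude_apply he.injective, wordBarycenter]
  · have : f i ∉ w.word := fun h => by
      obtain ⟨a, ha⟩ := hq _ h
      exact hi ⟨a, hf.1 ha⟩
    simp [faceInclude_of_notMem _ hi, wordBarycenter, this]

open Classical in
/-- Slide a point of the realization towards the barycenter of a face. -/
noncomputable def realSlide (w : K.Word) : OrdRealization K → C(I, OrdRealization K) :=
  Quot.lift (fun p => if w ≤ ptWord p then ordMk.comp (slide w p) else .const _ (ordMk p))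
    fun p q h => by
      rw [ptWord_eq_of_ordRel h]
      split_ifs with hw
      · ext t
        exact ordMk_slide_eq h hw t
      · exact congrArg _ (Quot.sound h)

theorem realSlide_mk {w : K.Word} {p : OrdPts K} (h : w ≤ ptWord p) (t : I) :
    realSlide w (ordMk p) t = ordMk (slide w p t) :=
  DFunLike.congr_fun (if_pos h : realSlide w (ordMk p) = ordMk.comp (slide w p)) t

theorem continuousOn_realSlide (w : K.Word) :
    ContinuousOn (realSlide w) (realWord ⁻¹' Ici (Topology.WithUpperSet.toUpperSet w)) := by
  have h1 : IsQuotientMap (ordMk : OrdPts K → OrdRealization K) := isQuotientMap_quot_mk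
  rw [h1.continuousOn_isOpen_iff ((isOpen_Ici_upper _).preimage continuous_realWord)]
  refine (Continuous.continuousOn (f := fun p => ordMk.comp (slide w p)) ?_).congr fun p hp => ?_
  · exact (ContinuousMap.continuous_postcomp _).comp (continuous_slide w)
  · ext t
    exact realSlide_mk hp t

theorem cubeExt_realWord (w : K.Word) (d : ℕ) :
    CubeExt (realWord ⁻¹' Ici (Topology.WithUpperSet.toUpperSet w)) d := by
  obtain ⟨m, hm⟩ : ∃ m, m + 1 = w.word.length :=
    ⟨_, Nat.succ_pred_eq_of_pos (List.length_pos_iff.2 w.ne_nil)⟩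
  let g : Fin (m + 1) → V := fun i => w.word.get (i.cast hm)
  have hg : Function.Injective g :=
    (List.nodup_iff_injective_get.1 w.nodup).comp (Fin.cast_injective hm)
  have hgr : ∀ v, v ∈ w.word ↔ v ∈ range g := fun v => by
    rw [List.mem_iff_get]
    exact ⟨fun ⟨i, hi⟩ => ⟨i.cast hm.symm, hi⟩, fun ⟨i, hi⟩ => ⟨_, hi⟩⟩
  have hgK : Finset.univ.image g ∈ K.faces := by
    convert w.mem using 1
    ext v
    simp [hgr]
  let b : stdSimplexSet (m + 1) :=
    ⟨_, wordBarycenter_mem w.nodup w.ne_nil hg fun v hv => (hgr v).1 hv⟩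
  let c : OrdRealization K := ordMk ⟨⟨m, g, hg, hgK⟩, b⟩
  have hlen : (w.word.length : ℝ) ≠ 0 := by simpa using w.ne_nil
  have hle : ∀ p : OrdPts K, w ≤ ptWord p → ∀ t, w ≤ ptWord (slide w p t) := by
    intro p hp t
    rw [slide_apply (mem_range_of_le_ptWord hp)]
    refine sublist_suppList p.1.2.2.1 hp fun i hi => ?_
    obtain ⟨i', h1, h2⟩ := mem_suppList.1 ((Word.le_def.1 hp).subset hi)
    obtain rfl := p.1.2.2.1 h2
    have h3 : 0 < p.2.1 i' := (p.2.2.1 i').lt_of_ne' h1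
    have h4 : 0 < wordBarycenter w.word p.1.2.1 i' := by
      rw [wordBarycenter, if_pos hi]
      positivity
    have h5 := t.2.1
    have h6 := t.2.2
    rcases eq_or_lt_of_le h5 with h | h
    · simp [← h, h3.ne']
    · exact (add_pos_of_nonneg_of_pos (mul_nonneg (sub_nonneg.2 h6) h3.le) (mul_pos h h4)).ne'
  have hend : ∀ p : OrdPts K, w ≤ ptWord p → ordMk (slide w p 1) = c := by
    intro p hp
    rw [slide_apply (mem_range_of_le_ptWord hp)]
    obtain ⟨e, he, hge⟩ := exists_strictMono_of_sublist hp hm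
    refine ordRealization_mk_eq p.1.2.2 ⟨hg, hgK⟩ he hge _ b (fun i => ?_) fun i hi => ?_
    · simp [b, wordBarycenter, ← hge, g]
    · have : p.1.2.1 i ∉ w.word := fun h => by
        obtain ⟨a, ha⟩ := (hgr _).1 h
        exact hi ⟨a, p.1.2.2.1 ((hge a).symm.trans ha)⟩
      simp [wordBarycenter, this]
  have hc : w ≤ ptWord ⟨⟨m, g, hg, hgK⟩, b⟩ := by
    change w.word.Sublist (suppList g b.1)
    have : suppList g b.1 = w.word := by
      rw [suppList, List.filter_eq_self.2, ← List.ofFn_eq_map]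
      · exact List.ext_getElem (by simp [hm]) fun i _ _ => by rw [List.getElem_ofFn]; rfl
      · intro i _
        have : g i ∈ w.word := (hgr _).2 ⟨i, rfl⟩
        simpa [b, wordBarycenter, this] using w.ne_nil
    rw [this]
  refine cubeExt_of_contraction (fun q => realSlide w q.1 (projIcc 0 1 zero_le_one q.2)) c hc
    ?_ ?_ ?_ ?_ d
  · exact ((continuousOn_realSlide w).comp continuousOn_fst fun q hq => hq.1).eval
      (continuous_projIcc.comp continuous_snd).continuousOn
  · rintro ⟨q, t⟩ ⟨hq, -⟩
    obtain ⟨p, rfl⟩ := ordMk_surjective q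
    replace hq : w ≤ ptWord p := hq
    change realSlide w (ordMk p) (projIcc 0 1 zero_le_one t) ∈ realWord ⁻¹' _
    rw [realSlide_mk hq]
    exact hle p hq _
  · intro q hq
    obtain ⟨p, rfl⟩ := ordMk_surjective q
    replace hq : w ≤ ptWord p := hq
    change realSlide w (ordMk p) _ = ordMk p
    rw [realSlide_mk hq, slide_apply (mem_range_of_le_ptWord hq)]
    simp
    rfl
  · intro q hq
    obtain ⟨p, rfl⟩ := ordMk_surjective q
    replace hq : w ≤ ptWord p := hq
    change realSlide w (ordMk p) _ = c
    rw [realSlide_mk hq, projIcc_right]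
    exact hend p hq

theorem cubeExt_ordRealization {n : ℤ} (h : WCM K n) (d : ℕ) (hd : (d : ℤ) ≤ n) :
    CubeExt (univ : Set (OrdRealization K)) d :=
  CubeExt.comap_of_fibers continuous_realWord (fun w d => cubeExt_realWord w.ofUpperSet d)
    (posetExt_word h d hd)

theorem nonempty_ordRealization {n : ℤ} (h : WCM K n) (hn : 0 ≤ n) :
    Nonempty (OrdRealization K) := by
  obtain ⟨τ, hτ⟩ := h.1.nonempty_face (by omega)
  obtain ⟨v, hv⟩ := K.nonempty_of_mem hτ
  refine ⟨ordMk ⟨⟨0, fun _ => v, fun _ _ _ => Subsingleton.elim (α := Fin 1) _ _, ?_⟩, ⟨fun _ => 1, ?_⟩⟩⟩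
  · exact K.down_closed hτ (by simpa using hv) (by simp)
  · simp [stdSimplexSet]

end ASC

end

/-- If `K` is weakly Cohen–Macaulay of level `n`, then the ordered complex `K^{ord}` is
`(n−1)`-connected. -/
theorem ordered_complex_connectivity {V : Type} [DecidableEq V] (K : ASC V) (n : ℤ)
    (h : WCM K n) : IsConn (OrdRealization K) (n - 1) := by
  exact isConn_iff_cubeExt.2 ⟨fun hn => ASC.nonempty_ordRealization h (by omega),
    fun d hd => ASC.cubeExt_ordRealization h d (by omega)⟩
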